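/- arXiv:2011.05068 — 2 statements merged into one kernel-verified Lean document; each statement's English description precedes it below -/
import Mathlib

section
/- Let X_1,…,X_n be i.i.d. from a distribution P on ℝ^d that is symmetric about the origin (X and −X have the same law). For j = 1,…,J let ε_j = (ε_{1,j},…,ε_{m_1,j}) be mutually independent vectors of i.i.d. Rademacher random variables, independent of the data, and let T_mean^{ε_j} be the studentized cross statistic computed from ( ε_{1,j} f_mean(X_1),…, ε_{m_1,j} f_mean(X_{m_1}) ). Define p_sym^† = (1/(J+1)) [ 1 + ∑_{j=1}^J 1{ T_mean ≥ T_mean^{ε_j} } ]. Then, without any moment assumption and for all finite n, d, J, P( p_sym^† ≤ α ) ≤ α for every α ∈ [0,1]; in particular sup over all such symmetric P of E[ 1{ p_sym^† ≤ α } ] ≤ α. -/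
/-!
Statement 4: Finite-sample validity of the sign-flipped p-value `p_sym^†`
(Corollary 1 of Kim & Ramdas).  If the data distribution `P` on `ℝ^d` is symmetric
about the origin, and `ε_1, …, ε_J` are mutually independent vectors of i.i.d.
Rademacher signs independent of the data, then the p-value
`p_sym^† = (1 + #{j : T_mean ≥ T_mean^{ε_j}})/(J+1)` satisfies
`P(p_sym^† ≤ α) ≤ α` for every `α ∈ [0,1]`, without any moment assumption.
-/

open MeasureTheory ProbabilityTheory Filter

noncomputable section

/-- Euclidean dot product on `Fin d → ℝ`. -/
def dot {d : ℕ} (x y : Fin d → ℝ) : ℝ := ∑ i, x i * y i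

/-- Studentized statistic of a sample of reals. -/
def studentized (m : ℕ) (y : Fin m → ℝ) : ℝ :=
  Real.sqrt m * ((∑ i, y i) / m) /
    Real.sqrt ((∑ i, (y i - (∑ j, y j) / m) ^ 2) / m)

/-- The studentized cross mean statistic computed from the sign-modified values
`e_i · f_mean(X_i)`, where `f_mean(x) = μ̂₂ᵀx`.  Taking `e ≡ 1` recovers `T_mean`. -/
def TmeanSigned (d m₁ m₂ : ℕ) (e : Fin m₁ → ℝ) (ω : Fin (m₁ + m₂) → Fin d → ℝ) : ℝ :=
  studentized m₁ fun i =>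
    e i * dot (fun j => (∑ k : Fin m₂, ω (Fin.natAdd m₁ k) j) / m₂) (ω (Fin.castAdd m₂ i))

open Classical in
/-- The sign-flipping p-value `p_sym^†`. -/
def psymDagger (d m₁ m₂ J : ℕ) (ω : Fin (m₁ + m₂) → Fin d → ℝ)
    (e : Fin J → Fin m₁ → ℝ) : ℝ :=
  (1 + (Finset.univ.filter fun j : Fin J =>
      TmeanSigned d m₁ m₂ (e j) ω ≤ TmeanSigned d m₁ m₂ (fun _ => 1) ω).card) / (J + 1)

/-- The Rademacher distribution on `ℝ`: `±1` with probability `1/2` each. -/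
def rademacher : Measure ℝ :=
  (1 / 2 : ENNReal) • Measure.dirac (1 : ℝ) + (1 / 2 : ENNReal) • Measure.dirac (-1 : ℝ)

lemma psd_card_rank_le {n : ℕ} (t : Fin n → ℝ) (x : ℝ) (hx : 0 ≤ x) :
    (((Finset.univ.filter fun i : Fin n =>
      ((Finset.univ.filter fun j : Fin n => t j ≤ t i).card : ℝ) ≤ x).card : ℕ) : ℝ) ≤ x := by
  classical
  set S := Finset.univ.filter fun i : Fin n =>
      ((Finset.univ.filter fun j : Fin n => t j ≤ t i).card : ℝ) ≤ x with hS
  rcases S.eq_empty_or_nonempty with h | h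
  · rw [h]; simpa using hx
  · obtain ⟨i, hi, hmax⟩ := S.exists_max_image t h
    have h1 : S ⊆ Finset.univ.filter fun j : Fin n => t j ≤ t i := by
      intro j hj
      simpa using hmax j hj
    have h2 : ((Finset.univ.filter fun j : Fin n => t j ≤ t i).card : ℝ) ≤ x := by
      rw [hS, Finset.mem_filter] at hi
      exact hi.2
    exact le_trans (by exact_mod_cast Finset.card_le_card h1) h2

lemma psd_measurable_card {Ω : Type*} [MeasurableSpace Ω] {n : ℕ} (f g : Fin n → Ω → ℝ)
    (hf : ∀ i, Measurable (f i)) (hg : ∀ i, Measurable (g i)) :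
    Measurable fun p => ((Finset.univ.filter fun j : Fin n => f j p ≤ g j p).card : ℝ) := by
  classical
  have : (fun p => ((Finset.univ.filter fun j : Fin n => f j p ≤ g j p).card : ℝ))
      = fun p => ∑ j : Fin n, if f j p ≤ g j p then (1 : ℝ) else 0 := by
    funext p
    simp
  rw [this]
  refine Finset.measurable_sum _ fun j _ => ?_
  exact Measurable.ite (measurableSet_le (hf j) (hg j)) measurable_const measurable_const

set_option maxHeartbeats 1000000 in
lemma psd_exch {E : Type*} [MeasurableSpace E] (ρ : Measure E) [IsProbabilityMeasure ρ]
    (J : ℕ) (h : E → ℝ) (hh : Measurable h) (α : ℝ) (hα : 0 ≤ α) :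
    (Measure.pi fun _ : Fin (J + 1) => ρ)
      {e | ((Finset.univ.filter fun j : Fin (J + 1) => h (e j) ≤ h (e 0)).card : ℝ)
        ≤ α * (J + 1)} ≤ ENNReal.ofReal α := by
  classical
  set ν := Measure.pi fun _ : Fin (J + 1) => ρ with hν
  set B : Fin (J + 1) → Set (Fin (J + 1) → E) := fun i =>
    {e | ((Finset.univ.filter fun j : Fin (J + 1) => h (e j) ≤ h (e i)).card : ℝ)
        ≤ α * (J + 1)} with hB
  have hBm : ∀ i, MeasurableSet (B i) := by
    intro i
    have hm := psd_measurable_card (fun (j : Fin (J + 1)) (e : Fin (J + 1) → E) => h (e j))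
      (fun _ e => h (e i))
      (fun j => hh.comp (measurable_pi_apply j)) (fun j => hh.comp (measurable_pi_apply i))
    exact measurableSet_le hm measurable_const
  have hBeq : ∀ i, ν (B i) = ν (B 0) := by
    intro i
    have mp := measurePreserving_piCongrLeft (fun _ : Fin (J + 1) => ρ) (Equiv.swap 0 i)
    rw [← mp.measure_preimage (hBm i).nullMeasurableSet]
    congr 1
    ext e
    have key : ∀ j, (MeasurableEquiv.piCongrLeft (fun _ : Fin (J + 1) => E) (Equiv.swap 0 i)) e j
        = e (Equiv.swap 0 i j) := by
      intro j
      have := Equiv.piCongrLeft_apply_apply (fun _ : Fin (J + 1) => E) (Equiv.swap 0 i) e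
        (Equiv.swap 0 i j)
      rw [Equiv.swap_apply_self] at this
      exact this
    simp only [hB, Set.mem_preimage, Set.mem_ofPred_eq, key, Equiv.swap_apply_right]
    have : (Finset.univ.filter fun j : Fin (J + 1) => h (e (Equiv.swap 0 i j)) ≤ h (e 0)).card
      = (Finset.univ.filter fun j : Fin (J + 1) => h (e j) ≤ h (e 0)).card := by
      refine Finset.card_equiv (Equiv.swap 0 i) ?_
      intro j
      simp
    rw [this]
  have hsum : ((J + 1 : ℕ) : ENNReal) * ν (B 0) ≤ ENNReal.ofReal (α * (J + 1)) := by
    calc ((J + 1 : ℕ) : ENNReal) * ν (B 0) = ∑ i, ν (B i) := by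
          simp [hBeq]
      _ = ∫⁻ e, ∑ i, (B i).indicator 1 e ∂ν := by
          rw [lintegral_finsetSum _ (fun i _ => measurable_one.indicator (hBm i))]
          simp [hBm]
      _ ≤ ∫⁻ e, ENNReal.ofReal (α * (J + 1)) ∂ν := by
          refine lintegral_mono fun e => ?_
          have h1 := psd_card_rank_le (fun j => h (e j)) (α * (J + 1)) (by positivity)
          have h2 : ∑ i, (B i).indicator (1 : (Fin (J + 1) → E) → ENNReal) e
            = ((Finset.univ.filter fun i : Fin (J + 1) => e ∈ B i).card : ENNReal) := by
            simp [Set.indicator_apply]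
          rw [h2, ← ENNReal.ofReal_natCast]
          refine ENNReal.ofReal_le_ofReal (le_trans (le_of_eq ?_) h1)
          congr 2
      _ = _ := by simp
  rw [ENNReal.ofReal_mul hα, mul_comm] at hsum
  have h3 : ENNReal.ofReal ((J : ℝ) + 1) = ((J + 1 : ℕ) : ENNReal) := by
    rw [← ENNReal.ofReal_natCast]; push_cast; rfl
  rw [h3] at hsum
  exact (ENNReal.mul_le_mul_iff_left (by simp) (ENNReal.natCast_ne_top _)).1 hsum

instance psd_rad_prob : IsProbabilityMeasure rademacher := by
  constructor
  simp [rademacher, ENNReal.inv_two_add_inv_two]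

lemma psd_rad_neg : MeasurePreserving (fun x : ℝ => -x) rademacher rademacher := by
  refine ⟨measurable_neg, ?_⟩
  unfold rademacher
  rw [Measure.map_add _ _ measurable_neg, Measure.map_smul, Measure.map_smul,
    Measure.map_dirac' measurable_neg, Measure.map_dirac' measurable_neg, neg_neg, add_comm]

lemma psd_rad_ae : ∀ᵐ x ∂rademacher, x = 1 ∨ x = -1 := by
  have hm : MeasurableSet {x : ℝ | x = 1 ∨ x = -1} :=
    (measurableSet_singleton 1).union (measurableSet_singleton (-1))
  rw [ae_iff]
  have : MeasurableSet {x : ℝ | ¬ (x = 1 ∨ x = -1)} := hm.compl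
  simp [rademacher, Measure.dirac_apply' _ this]

lemma psd_rad_mul (c : ℝ) (hc : c = 1 ∨ c = -1) :
    MeasurePreserving (fun x : ℝ => c * x) rademacher rademacher := by
  rcases hc with rfl | rfl
  · simp only [one_mul]; exact MeasurePreserving.id rademacher
  · simpa using psd_rad_neg

lemma psd_dot_smul {d : ℕ} (x y : Fin d → ℝ) (c : ℝ) : dot x (c • y) = c * dot x y := by
  simp only [dot, Finset.mul_sum, Pi.smul_apply, smul_eq_mul]
  exact Finset.sum_congr rfl fun i _ => by ring

lemma psd_T_meas (d m₁ m₂ : ℕ) : Measurable fun p : (Fin m₁ → ℝ) × (Fin (m₁ + m₂) → Fin d → ℝ) =>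
    TmeanSigned d m₁ m₂ p.1 p.2 := by
  unfold TmeanSigned studentized dot
  fun_prop

lemma psd_T_flip (d m₁ m₂ : ℕ) (s e : Fin m₁ → ℝ) (ω : Fin (m₁ + m₂) → Fin d → ℝ) :
    TmeanSigned d m₁ m₂ e (fun i => (Fin.addCases s (fun _ => 1) i : ℝ) • ω i)
      = TmeanSigned d m₁ m₂ (fun i => s i * e i) ω := by
  unfold TmeanSigned
  congr 1
  funext i
  simp only [Fin.addCases_left, Fin.addCases_right, one_smul, psd_dot_smul]
  ring

lemma psd_card_succ {E : Type*} (J : ℕ) (h : E → ℝ) (s : E) (e : Fin J → E) :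
    ((Finset.univ.filter fun j : Fin (J + 1) =>
      h ((Fin.cons s e : Fin (J + 1) → E) j) ≤ h ((Fin.cons s e : Fin (J + 1) → E) 0)).card : ℝ)
      = 1 + ((Finset.univ.filter fun j : Fin J => h (e j) ≤ h s).card : ℝ) := by
  rw [Fin.univ_succ, Finset.filter_cons]
  simp [Finset.filter_map, Function.comp_def]
  ring

set_option maxHeartbeats 1000000 in
theorem psym_dagger_finite_sample_valid
    (d m₁ m₂ J : ℕ) (α : ℝ) (hα0 : 0 ≤ α) (hα1 : α ≤ 1)
    (P : Measure (Fin d → ℝ)) (hP : IsProbabilityMeasure P)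
    (hsym : P.map (fun x => -x) = P) :
    ((Measure.pi fun _ : Fin (m₁ + m₂) => P).prod
        (Measure.pi fun _ : Fin J => Measure.pi fun _ : Fin m₁ => rademacher))
      {p | psymDagger d m₁ m₂ J p.1 p.2 ≤ α} ≤ ENNReal.ofReal α := by
  classical
  set ρ : Measure (Fin m₁ → ℝ) := Measure.pi fun _ : Fin m₁ => rademacher with hρ
  set Q := Measure.pi fun _ : Fin (m₁ + m₂) => P with hQ
  set R := Measure.pi fun _ : Fin J => ρ with hR
  set T := TmeanSigned d m₁ m₂ with hT
  -- the symmetrized event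
  set C : Set ((Fin m₁ → ℝ) × ((Fin (m₁ + m₂) → Fin d → ℝ) × (Fin J → Fin m₁ → ℝ))) :=
    {q | 1 + ((Finset.univ.filter fun j : Fin J => T (q.2.2 j) q.2.1 ≤ T q.1 q.2.1).card : ℝ)
      ≤ α * (J + 1)} with hC
  have hTm := psd_T_meas d m₁ m₂
  have hCm : MeasurableSet C := by
    have hm := psd_measurable_card
      (fun (j : Fin J) (q : (Fin m₁ → ℝ) × ((Fin (m₁ + m₂) → Fin d → ℝ) × (Fin J → Fin m₁ → ℝ))) =>
        T (q.2.2 j) q.2.1) (fun _ q => T q.1 q.2.1) (fun j => ?_) (fun j => ?_)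
    · rw [hC]
      exact measurableSet_le (hm.const_add 1) measurable_const
    · exact hTm.comp (f := fun q : (Fin m₁ → ℝ) × ((Fin (m₁ + m₂) → Fin d → ℝ) ×
        (Fin J → Fin m₁ → ℝ)) => (q.2.2 j, q.2.1)) (by fun_prop)
    · exact hTm.comp (f := fun q : (Fin m₁ → ℝ) × ((Fin (m₁ + m₂) → Fin d → ℝ) ×
        (Fin J → Fin m₁ → ℝ)) => (q.1, q.2.1)) (by fun_prop)
  set A : Set ((Fin (m₁ + m₂) → Fin d → ℝ) × (Fin J → Fin m₁ → ℝ)) :=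
    {p | psymDagger d m₁ m₂ J p.1 p.2 ≤ α} with hA
  have hJ : (0 : ℝ) < J + 1 := by positivity
  have hAC : A = Prod.mk (fun _ => (1 : ℝ)) ⁻¹' C := by
    ext p
    simp only [hA, hC, Set.mem_ofPred_eq, Set.mem_preimage, psymDagger, div_le_iff₀ hJ, hT]
  have hAm : MeasurableSet A := by
    rw [hAC]; exact measurable_prodMk_left hCm
  have hPneg : MeasurePreserving (fun x : Fin d → ℝ => -x) P P := ⟨measurable_neg, hsym⟩
  have hflip : ∀ s : Fin m₁ → ℝ, (∀ i, s i = 1 ∨ s i = -1) →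
      (Q.prod R) A = (Q.prod R) (Prod.mk s ⁻¹' C) := by
    intro s hs
    have hc : ∀ i : Fin (m₁ + m₂), (Fin.addCases s (fun _ => 1) i : ℝ) = 1 ∨
        (Fin.addCases s (fun _ => 1) i : ℝ) = -1 := by
      intro i
      refine Fin.addCases (fun i => ?_) (fun i => ?_) i
      · simpa using hs i
      · simp
    have mp1 : MeasurePreserving (fun (ω : Fin (m₁ + m₂) → Fin d → ℝ) i =>
        (Fin.addCases s (fun _ => 1) i : ℝ) • ω i) Q Q := by
      refine measurePreserving_pi (fun _ => P) (fun _ => P)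
        (f := fun i x => (Fin.addCases s (fun _ => 1) i : ℝ) • x) fun i => ?_
      rcases hc i with h | h
      · simp only [h, one_smul]; exact MeasurePreserving.id P
      · simpa [h] using hPneg
    have mp2 : MeasurePreserving (fun (x : Fin m₁ → ℝ) i => s i * x i) ρ ρ :=
      measurePreserving_pi (fun _ => rademacher) (fun _ => rademacher)
        (f := fun i x => s i * x) fun i => psd_rad_mul _ (hs i)
    have mp3 : MeasurePreserving (fun (e : Fin J → Fin m₁ → ℝ) j i => s i * e j i) R R :=
      measurePreserving_pi (fun _ => ρ) (fun _ => ρ)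
        (f := fun _ x i => s i * x i) fun _ => mp2
    have mp := mp1.prod mp3
    rw [← mp.measure_preimage hAm.nullMeasurableSet]
    congr 1
    have hss : ∀ i, s i * s i = 1 := fun i => by rcases hs i with h | h <;> simp [h]
    ext p
    simp only [hAC, hC, Set.mem_ofPred_eq, Set.mem_preimage, Prod.map, hT, psd_T_flip,
      ← mul_assoc, hss, one_mul, mul_one]
  have hae : ∀ᵐ s ∂ρ, ∀ i, s i = 1 ∨ s i = -1 := by
    rw [ae_all_iff]
    intro i
    exact (Measure.tendsto_eval_ae_ae (μ := fun _ : Fin m₁ => rademacher) (i := i)).eventually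
      psd_rad_ae
  have h1 : (Q.prod R) A = (ρ.prod (Q.prod R)) C := by
    rw [Measure.prod_apply hCm]
    rw [← lintegral_congr_ae (hae.mono fun s hs => hflip s hs)]
    simp
  have h2 : (ρ.prod (Q.prod R)) C = ∫⁻ ω, (ρ.prod R) {q | (q.1, (ω, q.2)) ∈ C} ∂Q := by
    rw [← lintegral_indicator_one hCm, lintegral_prod _ (measurable_one.indicator hCm).aemeasurable]
    have e1 : ∀ s, ∫⁻ y, C.indicator 1 (s, y) ∂(Q.prod R)
        = ∫⁻ ω, (∫⁻ e, C.indicator 1 (s, (ω, e)) ∂(R)) ∂(Q) := by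
      intro s
      rw [lintegral_prod]
      exact ((measurable_one.indicator hCm).comp measurable_prodMk_left).aemeasurable
    simp_rw [e1]
    rw [lintegral_lintegral_swap]
    · refine lintegral_congr fun ω => ?_
      have hm : MeasurableSet {q : (Fin m₁ → ℝ) × (Fin J → Fin m₁ → ℝ) | (q.1, (ω, q.2)) ∈ C} :=
        (show Measurable fun q : (Fin m₁ → ℝ) × (Fin J → Fin m₁ → ℝ) => (q.1, (ω, q.2)) by
          fun_prop) hCm
      rw [← lintegral_indicator_one hm, lintegral_prod _ (measurable_one.indicator hm).aemeasurable]
      rfl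
    · refine Measurable.aemeasurable ?_
      refine Measurable.lintegral_prod_right' (f := fun z : ((Fin m₁ → ℝ) ×
        (Fin (m₁ + m₂) → Fin d → ℝ)) × (Fin J → Fin m₁ → ℝ) =>
          Set.indicator C (fun _ => (1 : ENNReal)) (z.1.1, (z.1.2, z.2))) ?_
      exact (measurable_one.indicator hCm).comp (by fun_prop)
  rw [h1, h2]
  have h3 : ∀ ω, (ρ.prod R) {q | (q.1, (ω, q.2)) ∈ C} ≤ ENNReal.ofReal α := by
    intro ω
    have hTω : Measurable fun s => T s ω := hTm.comp measurable_prodMk_right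
    have hex := psd_exch ρ J (fun s => T s ω) hTω α hα0
    have mp := (measurePreserving_piFinSuccAbove (fun _ : Fin (J + 1) => ρ) 0).symm
    rw [← mp.measure_preimage_equiv] at hex
    convert hex using 2
    ext ⟨s, e⟩
    have := psd_card_succ J (fun s => T s ω) s e
    have hcons : (MeasurableEquiv.piFinSuccAbove (fun _ : Fin (J + 1) => Fin m₁ → ℝ) 0).symm (s, e)
        = (Fin.cons s e : Fin (J + 1) → Fin m₁ → ℝ) := by
      simp [MeasurableEquiv.piFinSuccAbove, Fin.insertNthEquiv]
    simp only [Set.mem_preimage, Set.mem_ofPred_eq, hC, hcons]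
    rw [this]
  calc _ ≤ ∫⁻ ω, ENNReal.ofReal α ∂Q := lintegral_mono h3
    _ = _ := by simp

end
end

section
/- Let 𝒫_{0,n,cov} be the class of continuous distributions of X ∈ ℝ^d whose coordinates z_1,…,z_d satisfy E[z_i] = 0, E[z_i z_j] = δ_{ij}, E[z_i⁴] = 3 + Δ with Δ + 2 > c for a fixed constant c > 0, E[z_i⁸] ≤ C₀ for a fixed constant C₀, and whose product moments factorize: E[ z_{ℓ_1}^{α_1} ⋯ z_{ℓ_q}^{α_q} ] = ∏_{i} E[ z_{ℓ_i}^{α_i} ] for any distinct indices ℓ_1,…,ℓ_q and nonnegative exponents with ∑_ℓ α_ℓ ≤ 8. Then there exists a constant C > 0 (depending only on c and C₀) such that sup_{P ∈ 𝒫_{0,n,cov}} sup_{z ∈ ℝ} | P_P( T_cov ≤ z ) − Φ(z) | ≤ C / √m_1, for all n = m_1 + m_2 and all dimensions d. -/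
/-!
Statement 9: Uniform Berry–Esseen bound for the studentized cross covariance statistic
`T_cov` over the covariance model class `𝒫_{0,n,cov}` (Proposition 2 /
Definition 1 of Kim & Ramdas).  The class consists of continuous distributions whose
coordinates have mean 0, identity second moments, fourth moment `3 + Δ` with
`Δ + 2 > c`, eighth moments bounded by `C₀`, and factorizing product moments up to
total order 8.  There is a constant `C > 0` (depending only on `c, C₀`) with
`sup_P sup_z |P(T_cov ≤ z) − Φ(z)| ≤ C/√m₁` for all `n = m₁ + m₂` and all `d`.
-/

open MeasureTheory ProbabilityTheory Filter

noncomputable section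

/-- Standard normal cumulative distribution function. -/
def Φ (z : ℝ) : ℝ := ∫ t in Set.Iic z, Real.exp (-t ^ 2 / 2) / Real.sqrt (2 * Real.pi)

/-- The covariance kernel `tr{(xxᵀ − I)(yyᵀ − I)} = (xᵀy)² − xᵀx − yᵀy + d`. -/
def hCov (d : ℕ) (x y : Fin d → ℝ) : ℝ :=
  dot x y ^ 2 - dot x x - dot y y + d

/-- The studentized cross covariance statistic `T_cov`. -/
def Tcov (d m₁ m₂ : ℕ) (ω : Fin (m₁ + m₂) → Fin d → ℝ) : ℝ :=
  studentized m₁ fun i =>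
    (∑ j : Fin m₂, hCov d (ω (Fin.castAdd m₂ i)) (ω (Fin.natAdd m₁ j))) / m₂

/-- The covariance model class `𝒫_{0,n,cov}`: continuous distribution, coordinates with
mean zero, identity covariance, common fourth moment `3 + Δ`, eighth moments bounded by
`C₀`, and factorizing mixed moments up to total order `8`. -/
def CovModel {d : ℕ} (P : Measure (Fin d → ℝ)) (Δ C₀ : ℝ) : Prop :=
  IsProbabilityMeasure P ∧
  (∀ x, P {x} = 0) ∧
  (∀ β : Fin d → ℕ, (∑ i, β i) ≤ 8 →
    Integrable (fun x => ∏ i, x i ^ β i) P ∧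
    ∫ x, ∏ i, x i ^ β i ∂P = ∏ i, ∫ x, x i ^ β i ∂P) ∧
  (∀ i, ∫ x, x i ∂P = 0) ∧
  (∀ i j, i ≠ j → ∫ x, x i * x j ∂P = 0) ∧
  (∀ i, ∫ x, x i ^ 2 ∂P = 1) ∧
  (∀ i, ∫ x, x i ^ 4 ∂P = 3 + Δ) ∧
  (∀ i, ∫ x, x i ^ 8 ∂P ≤ C₀)

/-- Standard normal density. -/
def phiD (t : ℝ) : ℝ := Real.exp (-t ^ 2 / 2) / Real.sqrt (2 * Real.pi)

lemma phiD_eq : phiD = gaussianPDFReal 0 1 := by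
  funext t
  simp [phiD, gaussianPDFReal]
  field_simp

lemma phiD_int : Integrable phiD := by
  rw [phiD_eq]; exact integrable_gaussianPDFReal 0 1

lemma phiD_total : ∫ t, phiD t = 1 := by
  rw [phiD_eq]; exact integral_gaussianPDFReal_eq_one 0 (by simp)

lemma phiD_pos (t : ℝ) : 0 < phiD t := by unfold phiD; positivity

lemma phiD_cont : Continuous phiD := by unfold phiD; fun_prop

lemma sqrt2pi_ge : 1 ≤ Real.sqrt (2 * Real.pi) := by
  apply Real.le_sqrt_of_sq_le; nlinarith [Real.pi_gt_three]

lemma sqrt2pi_le : Real.sqrt (2 * Real.pi) ≤ 3 := by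
  apply Real.sqrt_le_iff.2; constructor <;> nlinarith [Real.pi_lt_four]

lemma phiD_le (t : ℝ) : phiD t ≤ Real.exp (-t ^ 2 / 2) := by
  unfold phiD; exact div_le_self (Real.exp_pos _).le sqrt2pi_ge

lemma phiD_le_one (t : ℝ) : phiD t ≤ 1 := by
  refine (phiD_le t).trans ?_
  rw [Real.exp_le_one_iff]; nlinarith [sq_nonneg t]

lemma Phi_eq (z : ℝ) : Φ z = ∫ t in Set.Iic z, phiD t := rfl

lemma Phi_compl (z : ℝ) : 1 - Φ z = ∫ t in Set.Ioi z, phiD t := by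
  have := intervalIntegral.integral_Iic_add_Ioi (b := z) phiD_int.integrableOn phiD_int.integrableOn
  rw [phiD_total] at this
  rw [Phi_eq]; linarith

lemma Phi_nonneg (z : ℝ) : 0 ≤ Φ z := by
  rw [Phi_eq]; exact integral_nonneg fun t => (phiD_pos t).le

lemma Phi_le_one (z : ℝ) : Φ z ≤ 1 := by
  have : 0 ≤ 1 - Φ z := by
    rw [Phi_compl]; exact integral_nonneg fun t => (phiD_pos t).le
  linarith

lemma Phi_neg (z : ℝ) : Φ (-z) = 1 - Φ z := by
  rw [Phi_compl, Phi_eq]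
  have := integral_comp_neg_Ioi (c := z) (f := phiD)
  rw [← this]
  simp [phiD]

lemma Phi_hasDeriv (z : ℝ) : HasDerivAt Φ (phiD z) z := by
  have h1 : ∀ y, Φ y = Φ 0 + ∫ t in (0:ℝ)..y, phiD t := by
    intro y
    rw [Phi_eq, Phi_eq, ← intervalIntegral.integral_Iic_sub_Iic phiD_int.integrableOn phiD_int.integrableOn]
    ring
  have h2 : Φ = fun y => Φ 0 + ∫ t in (0:ℝ)..y, phiD t := funext h1
  rw [h2]
  exact (intervalIntegral.integral_hasDerivAt_right (phiD_int.intervalIntegrable)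
    phiD_cont.stronglyMeasurable.stronglyMeasurableAtFilter phiD_cont.continuousAt).const_add _

lemma Phi_cont : Continuous Φ :=
  continuous_iff_continuousAt.2 fun z => (Phi_hasDeriv z).continuousAt

lemma Phi_mono : Monotone Φ :=
  monotone_of_hasDerivAt_nonneg Phi_hasDeriv (fun z => (phiD_pos z).le)

lemma Phi_lip (s t : ℝ) : |Φ s - Φ t| ≤ |s - t| := by
  have := Convex.norm_image_sub_le_of_norm_hasDerivWithin_le (f := Φ) (f' := phiD) (s := Set.univ)
    (x := t) (y := s) (C := 1) (fun x _ => (Phi_hasDeriv x).hasDerivWithinAt)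
    (fun x _ => by rw [Real.norm_eq_abs, abs_of_pos (phiD_pos x)]; exact phiD_le_one x)
    convex_univ (Set.mem_univ _) (Set.mem_univ _)
  simpa using this

lemma mills_one {w : ℝ} (hw : 0 ≤ w) : Real.exp (w ^ 2 / 2) * (1 - Φ w) ≤ 1 := by
  have h : 1 - Φ w ≤ Real.exp (-w ^ 2 / 2) := by
    rw [Phi_compl]
    have hi : Integrable (fun t => Real.exp (-w ^ 2 / 2) * phiD (t - w)) :=
      (phiD_int.comp_sub_right w).const_mul _
    calc ∫ t in Set.Ioi w, phiD t ≤ ∫ t in Set.Ioi w, Real.exp (-w ^ 2 / 2) * phiD (t - w) := by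
          apply setIntegral_mono_on phiD_int.integrableOn hi.integrableOn measurableSet_Ioi
          intro t ht
          have ht : w < t := ht
          unfold phiD
          rw [← mul_div_assoc, ← Real.exp_add]
          gcongr
          nlinarith
      _ ≤ ∫ t, Real.exp (-w ^ 2 / 2) * phiD (t - w) :=
          setIntegral_le_integral hi (Eventually.of_forall fun t =>
            mul_nonneg (Real.exp_pos _).le (phiD_pos _).le)
      _ = Real.exp (-w ^ 2 / 2) := by
          rw [integral_const_mul, integral_sub_right_eq_self phiD w, phiD_total, mul_one]
  calc Real.exp (w ^ 2 / 2) * (1 - Φ w) ≤ Real.exp (w ^ 2 / 2) * Real.exp (-w ^ 2 / 2) := by gcongr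
    _ = 1 := by rw [← Real.exp_add]; simp; ring

lemma phiD_hasDeriv (t : ℝ) : HasDerivAt phiD (- t * phiD t) t := by
  unfold phiD
  have : HasDerivAt (fun t : ℝ => -t ^ 2 / 2) (-t) t := by
    have := ((hasDerivAt_pow 2 t).neg.div_const 2)
    refine this.congr_deriv ?_
    simp
    ring
  refine (this.exp.div_const _).congr_deriv ?_
  ring

lemma mills_two {w : ℝ} (hw : 0 ≤ w) : w * (Real.exp (w ^ 2 / 2) * (1 - Φ w)) ≤ 1 := by
  have h : w * (1 - Φ w) ≤ phiD w := by
    have hanti : Antitone (fun y => phiD y - y * (1 - Φ y)) := by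
      have hd : ∀ y, HasDerivAt (fun y => phiD y - y * (1 - Φ y)) (-(1 - Φ y)) y := by
        intro y
        have := (phiD_hasDeriv y).sub ((hasDerivAt_id y).mul ((Phi_hasDeriv y).const_sub 1))
        refine this.congr_deriv ?_
        simp
      have := antitone_of_hasDerivAt_nonpos hd
      apply this
      intro y; have := Phi_le_one y; simp; linarith
    have hlim : Tendsto (fun y => phiD y - y * (1 - Φ y)) atTop (nhds (0 - 0)) := by
      have e1 : Tendsto (fun y : ℝ => Real.exp (-y ^ 2 / 2)) atTop (nhds 0) := by
        apply Real.tendsto_exp_atBot.comp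
        have : Tendsto (fun y : ℝ => y ^ 2 / 2) atTop atTop :=
          (tendsto_pow_atTop (by norm_num)).atTop_div_const (by norm_num)
        have := tendsto_neg_atTop_atBot.comp this
        refine this.congr ?_
        intro x; simp; ring
      have e2 : Tendsto (fun y : ℝ => y * Real.exp (-y)) atTop (nhds 0) := by
        simpa using Real.tendsto_pow_mul_exp_neg_atTop_nhds_zero 1
      have hb : ∀ᶠ y : ℝ in atTop, y * (1 - Φ y) ≤ y * Real.exp (-y) := by
        filter_upwards [eventually_ge_atTop 2] with y hy
        have h1 := mills_one (w := y) (by linarith)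
        have h2 : 1 - Φ y ≤ Real.exp (-y) := by
          have h3 : Real.exp y ≤ Real.exp (y ^ 2 / 2) := Real.exp_le_exp.2 (by nlinarith)
          have h4 := Phi_le_one y
          rw [Real.exp_neg, ← one_div, le_div_iff₀ (Real.exp_pos _)]
          nlinarith
        gcongr
      refine Tendsto.sub ?_ ?_
      · exact squeeze_zero (fun y => (phiD_pos y).le) phiD_le e1
      · refine squeeze_zero' ?_ hb e2
        filter_upwards [eventually_ge_atTop 0] with y hy
        exact mul_nonneg hy (by linarith [Phi_le_one y])
    have := hanti.le_of_tendsto hlim w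
    simp at this; linarith
  calc w * (Real.exp (w ^ 2 / 2) * (1 - Φ w)) = Real.exp (w ^ 2 / 2) * (w * (1 - Φ w)) := by ring
    _ ≤ Real.exp (w ^ 2 / 2) * Real.exp (-w ^ 2 / 2) := by
      have := h.trans (phiD_le w)
      gcongr
    _ = 1 := by rw [← Real.exp_add]; simp; ring

/-- left branch -/
lemma left_bound {w z : ℝ} (h : w ≤ z) :
    (1 + |w|) * (Real.exp (w ^ 2 / 2) * Φ w * (1 - Φ z)) ≤ 2 := by
  have a1 := Phi_nonneg w
  have a2 := Phi_le_one w
  have a3 := Phi_le_one z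
  have a4 := Phi_nonneg z
  rcases le_total w 0 with hw | hw
  · have h1 := mills_one (w := -w) (by linarith)
    have h2 := mills_two (w := -w) (by linarith)
    rw [Phi_neg] at h1 h2
    rw [abs_of_nonpos hw]
    have e : (-w)^2 = w^2 := by ring
    rw [e] at h1 h2
    have h3 : (1 + -w) * (Real.exp (w ^ 2 / 2) * Φ w) ≤ 2 := by nlinarith
    have h4 : 0 ≤ (1 + -w) * (Real.exp (w ^ 2 / 2) * Φ w) := by
      have := Real.exp_pos (w^2/2)
      have : 0 ≤ 1 + -w := by linarith
      positivity
    nlinarith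
  · have h1 := mills_one (w := w) (by linarith)
    have h2 := mills_two (w := w) (by linarith)
    rw [abs_of_nonneg hw]
    have h5 := Phi_mono h
    have h6 : Real.exp (w ^ 2 / 2) * Φ w * (1 - Φ z) ≤ Real.exp (w ^ 2 / 2) * (1 - Φ w) := by
      rw [mul_assoc]
      have := Real.exp_pos (w^2/2)
      gcongr
      nlinarith
    nlinarith

lemma left_nonneg (w z : ℝ) : 0 ≤ Real.exp (w ^ 2 / 2) * Φ w * (1 - Φ z) :=
  mul_nonneg (mul_nonneg (Real.exp_pos _).le (Phi_nonneg _)) (by linarith [Phi_le_one z])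

/-- left branch of the Stein solution -/
def stL (z w : ℝ) : ℝ := Real.sqrt (2 * Real.pi) * (Real.exp (w ^ 2 / 2) * Φ w * (1 - Φ z))
/-- right branch of the Stein solution -/
def stR (z w : ℝ) : ℝ := stL (-z) (-w)

lemma stR_eq (z w : ℝ) : stR z w = Real.sqrt (2 * Real.pi) * (Real.exp (w ^ 2 / 2) * (1 - Φ w) * Φ z) := by
  unfold stR stL; rw [Phi_neg, Phi_neg]; simp

lemma stL_bound {w z : ℝ} (h : w ≤ z) : (1 + |w|) * |stL z w| ≤ 6 := by
  have h1 := left_bound h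
  have h2 := left_nonneg w z
  have h3 := sqrt2pi_le
  have h4 := sqrt2pi_ge
  unfold stL
  rw [abs_of_nonneg (mul_nonneg (by linarith) h2)]
  have h5 : 0 ≤ (1 + |w|) * (Real.exp (w ^ 2 / 2) * Φ w * (1 - Φ z)) := by positivity
  nlinarith

lemma stR_bound {w z : ℝ} (h : z ≤ w) : (1 + |w|) * |stR z w| ≤ 6 := by
  have := stL_bound (w := -w) (z := -z) (by linarith)
  simpa [stR] using this

lemma stL_deriv (z w : ℝ) : HasDerivAt (stL z) (w * stL z w + (1 - Φ z)) w := by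
  unfold stL
  have h1 : HasDerivAt (fun t : ℝ => Real.exp (t ^ 2 / 2)) (Real.exp (w ^ 2 / 2) * w) w := by
    have := ((hasDerivAt_pow 2 w).div_const 2)
    refine this.exp.congr_deriv ?_
    simp
  have h2 := (((h1.mul (Phi_hasDeriv w)).mul_const (1 - Φ z)).const_mul (Real.sqrt (2 * Real.pi)))
  refine h2.congr_deriv ?_
  have h3 : Real.sqrt (2 * Real.pi) * (Real.exp (w ^ 2 / 2) * phiD w) = 1 := by
    unfold phiD
    have := sqrt2pi_ge
    have e : Real.exp (-w ^ 2 / 2) = (Real.exp (w ^ 2 / 2))⁻¹ := by rw [← Real.exp_neg]; ring_nf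
    rw [e]; field_simp
  linear_combination (1 - Φ z) * h3

lemma stR_deriv (z w : ℝ) : HasDerivAt (stR z) (w * stR z w - Φ z) w := by
  have h := (stL_deriv (-z) (-w)).comp w (hasDerivAt_neg w)
  rw [Phi_neg] at h
  refine h.congr_deriv ?_
  unfold stR; ring

/-- Stein solution -/
def stF (z w : ℝ) : ℝ := if w ≤ z then stL z w else stR z w
/-- derivative of the Stein solution -/
def stD (z w : ℝ) : ℝ := w * stF z w + (if w ≤ z then 1 else 0) - Φ z

lemma stF_bound (z w : ℝ) : (1 + |w|) * |stF z w| ≤ 6 := by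
  unfold stF; split_ifs with h
  · exact stL_bound h
  · exact stR_bound (by linarith)

lemma stF_abs (z w : ℝ) : |stF z w| ≤ 6 := by
  have := stF_bound z w
  nlinarith [abs_nonneg w, abs_nonneg (stF z w)]

lemma stF_wabs (z w : ℝ) : |w * stF z w| ≤ 6 := by
  have := stF_bound z w
  rw [abs_mul]
  nlinarith [abs_nonneg w, abs_nonneg (stF z w)]

lemma stD_abs (z w : ℝ) : |stD z w| ≤ 7 := by
  have h1 := abs_le.1 (stF_wabs z w)
  have h2 := Phi_nonneg z
  have h3 := Phi_le_one z
  unfold stD; rw [abs_le]; split_ifs <;> constructor <;> linarith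

lemma stL_z (z : ℝ) : stL z z = stR z z := by rw [stR_eq]; unfold stL; ring

lemma stF_meas (z : ℝ) : Measurable (stF z) := by
  unfold stF
  refine Measurable.ite measurableSet_Iic ?_ ?_
  · exact (continuous_iff_continuousAt.2 fun w => (stL_deriv z w).continuousAt).measurable
  · exact (continuous_iff_continuousAt.2 fun w => (stR_deriv z w).continuousAt).measurable

lemma stD_meas (z : ℝ) : Measurable (stD z) := by
  unfold stD
  refine ((measurable_id.mul (stF_meas z)).add ?_).sub_const _
  exact Measurable.ite measurableSet_Iic measurable_const measurable_const

lemma stF_derivL (z w : ℝ) (hw : w ≤ z) : HasDerivWithinAt (stF z) (stD z w) (Set.Iic z) w := by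
  have h : HasDerivWithinAt (stL z) (stD z w) (Set.Iic z) w := by
    have := (stL_deriv z w).hasDerivWithinAt (s := Set.Iic z)
    refine this.congr_deriv ?_
    simp [stD, stF, hw]; ring
  refine h.congr (fun x hx => ?_) ?_
  · simp [stF, Set.mem_Iic.1 hx]
  · simp [stF, hw]

lemma stF_derivR (z w : ℝ) (hw : z < w) : HasDerivWithinAt (stF z) (stD z w) (Set.Ioi z) w := by
  have h : HasDerivWithinAt (stR z) (stD z w) (Set.Ioi z) w := by
    have := (stR_deriv z w).hasDerivWithinAt (s := Set.Ioi z)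
    refine this.congr_deriv ?_
    simp [stD, stF, not_le.2 hw]
  refine h.congr (fun x hx => ?_) ?_
  · simp [stF, not_le.2 (Set.mem_Ioi.1 hx)]
  · simp [stF, not_le.2 hw]

/-- mean value estimate on one side -/
lemma stF_mv (z x y B c : ℝ) (h : (x ≤ z ∧ y ≤ z) ∨ (z < x ∧ z < y))
    (hB : ∀ u ∈ Set.uIcc x y, ((u ≤ z ∧ x ≤ z) ∨ (z < u ∧ z < x)) → |stD z u - c| ≤ B) :
    |stF z y - stF z x - c * (y - x)| ≤ B * |y - x| := by
  have key : ∀ u ∈ Set.uIcc x y,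
      HasDerivWithinAt (fun u => stF z u - c * u) (stD z u - c) (Set.uIcc x y) u := by
    intro u hu
    have hc : HasDerivWithinAt (fun u : ℝ => c * u) c (Set.uIcc x y) u := by
      simpa using ((hasDerivAt_id u).const_mul c).hasDerivWithinAt (s := Set.uIcc x y)
    refine HasDerivWithinAt.sub ?_ hc
    rcases h with ⟨h1, h2⟩ | ⟨h1, h2⟩
    · have hs : Set.uIcc x y ⊆ Set.Iic z := fun u hu => (Set.mem_uIcc.1 hu).elim
        (fun q => q.2.trans h2) (fun q => q.2.trans h1)
      exact (stF_derivL z u (hs hu)).mono hs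
    · have hs : Set.uIcc x y ⊆ Set.Ioi z := fun u hu => (Set.mem_uIcc.1 hu).elim
        (fun q => lt_of_lt_of_le h1 q.1) (fun q => lt_of_lt_of_le h2 q.1)
      exact (stF_derivR z u (hs hu)).mono hs
  have := Convex.norm_image_sub_le_of_norm_hasDerivWithin_le (C := B) key
    (fun u hu => by
      rw [Real.norm_eq_abs]
      apply hB u hu
      rcases h with ⟨h1, h2⟩ | ⟨h1, h2⟩
      · exact Or.inl ⟨(Set.mem_uIcc.1 hu).elim (fun q => q.2.trans h2) (fun q => q.2.trans h1), h1⟩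
      · exact Or.inr ⟨(Set.mem_uIcc.1 hu).elim
          (fun q => lt_of_lt_of_le h1 q.1) (fun q => lt_of_lt_of_le h2 q.1), h1⟩)
    (convex_uIcc x y) Set.left_mem_uIcc Set.right_mem_uIcc
  rw [Real.norm_eq_abs, Real.norm_eq_abs] at this
  convert this using 2
  ring

lemma stF_lip (z x y : ℝ) : |stF z y - stF z x| ≤ 7 * |y - x| := by
  have same : ∀ x y, ((x ≤ z ∧ y ≤ z) ∨ (z < x ∧ z < y)) → |stF z y - stF z x| ≤ 7 * |y - x| := by
    intro x y h
    have := stF_mv z x y 7 0 h (fun u _ _ => by simpa using stD_abs z u)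
    simpa using this
  have cross : ∀ x y, x ≤ z → z < y → |stF z y - stF z x| ≤ 7 * |y - x| := by
    intro x y hx hy
    have h1 := same x z (Or.inl ⟨hx, le_rfl⟩)
    have h2 : |stR z y - stR z z| ≤ 7 * |y - z| := by
      have := Convex.norm_image_sub_le_of_norm_hasDerivWithin_le (f := stR z)
        (f' := fun w => w * stR z w - Φ z) (s := Set.Ici z) (x := z) (y := y) (C := 7)
        (fun u _ => (stR_deriv z u).hasDerivWithinAt)
        (fun u hu => by
          have h1 := stR_bound (w := u) (z := z) hu
          have h2 : |u * stR z u| ≤ 6 := by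
            rw [abs_mul]; nlinarith [abs_nonneg u, abs_nonneg (stR z u)]
          have h3 := Phi_nonneg z
          have h4 := Phi_le_one z
          have h5 := abs_le.1 h2
          rw [Real.norm_eq_abs, abs_le]; constructor <;> linarith)
        (convex_Ici z) (Set.mem_Ici.2 le_rfl) (Set.mem_Ici.2 hy.le)
      simpa using this
    have e1 : stF z z = stR z z := by simp [stF, stL_z]
    have e2 : stF z y = stR z y := by simp [stF, not_le.2 hy]
    rw [← e1, ← e2] at h2
    have h3 : |stF z y - stF z x| ≤ |stF z y - stF z z| + |stF z z - stF z x| := abs_sub_le _ _ _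
    rw [abs_of_nonneg (by linarith : 0 ≤ y - z)] at h2
    rw [abs_of_nonneg (by linarith : 0 ≤ z - x)] at h1
    rw [abs_of_nonneg (by linarith : 0 ≤ y - x)]
    linarith
  rcases le_or_gt x z with hx | hx <;> rcases le_or_gt y z with hy | hy
  · exact same x y (Or.inl ⟨hx, hy⟩)
  · exact cross x y hx hy
  · rw [abs_sub_comm, abs_sub_comm y x]; exact cross y x hy hx
  · exact same x y (Or.inr ⟨hx, hy⟩)

lemma stein_pw1 (z v a b : ℝ) : |stF z (v + a) - stF z v - a * stD z (v + b)| ≤ 14 * |a| := by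
  have h1 := stF_lip z v (v + a)
  have h2 := stD_abs z (v + b)
  have h3 : |a * stD z (v + b)| ≤ 7 * |a| := by rw [abs_mul]; nlinarith [abs_nonneg a]
  have h4 := abs_sub (stF z (v + a) - stF z v) (a * stD z (v + b))
  simp only [add_sub_cancel_left] at h1
  linarith

lemma stein_pw2 (z v a b : ℝ) (h : |a| + |b| < |v - z|) :
    |stF z (v + a) - stF z v - a * stD z (v + b)| ≤ 7 * ((|v| + 1) * (|a| + |b|)) * |a| := by
  have ha := abs_le.1 (le_refl |a|)
  have hb := abs_le.1 (le_refl |b|)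
  have ha0 := abs_nonneg a
  have hb0 := abs_nonneg b
  have hside : (v ≤ z ∧ v + a ≤ z ∧ v + b ≤ z) ∨ (z < v ∧ z < v + a ∧ z < v + b) := by
    rcases le_or_gt v z with hv | hv
    · left; rw [abs_of_nonpos (by linarith : v - z ≤ 0)] at h; refine ⟨hv, ?_, ?_⟩ <;> linarith
    · right; rw [abs_of_pos (by linarith : 0 < v - z)] at h; refine ⟨hv, ?_, ?_⟩ <;> linarith
  have := stF_mv z v (v + a) (7 * ((|v| + 1) * (|a| + |b|))) (stD z (v + b))
    (hside.imp (fun q => ⟨q.1, q.2.1⟩) (fun q => ⟨q.1, q.2.1⟩)) (by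
      intro u hu hs
      have hua : |u - v| ≤ |a| := by
        rcases Set.mem_uIcc.1 hu with q | q
        · rw [abs_le]; constructor <;> linarith
        · rw [abs_le]; constructor <;> linarith
      have e : stD z u - stD z (v + b) = v * (stF z u - stF z (v + b)) + (u - v) * stF z u
          - b * stF z (v + b) := by
        have : (if u ≤ z then (1:ℝ) else 0) = (if v + b ≤ z then 1 else 0) := by
          rcases hside with q | q
          · have : u ≤ z := by
              rcases hs with r | r
              · exact r.1
              · linarith [q.1, r.2]
            simp [this, q.2.2]
          · have : z < u := by
              rcases hs with r | r
              · linarith [q.1, r.2]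
              · exact r.1
            simp [not_le.2 this, not_le.2 q.2.2]
        unfold stD; rw [this]; ring
      rw [e]
      have t1 : |v * (stF z u - stF z (v + b))| ≤ 7 * (|v| * (|a| + |b|)) := by
        rw [abs_mul]
        have l1 := stF_lip z (v + b) u
        have l2 : |u - (v + b)| ≤ |a| + |b| := by
          have := abs_sub (u - v) b
          have e : u - (v + b) = u - v - b := by ring
          rw [e]; linarith
        have l3 : |stF z u - stF z (v + b)| ≤ 7 * (|a| + |b|) := by linarith
        nlinarith [abs_nonneg v]
      have t2 : |(u - v) * stF z u| ≤ 6 * |a| := by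
        rw [abs_mul]; nlinarith [stF_abs z u, abs_nonneg (u - v), abs_nonneg (stF z u)]
      have t3 : |b * stF z (v + b)| ≤ 6 * |b| := by
        rw [abs_mul]; nlinarith [stF_abs z (v + b)]
      have t4 := abs_sub (v * (stF z u - stF z (v + b)) + (u - v) * stF z u) (b * stF z (v + b))
      have t5 := abs_add_le (v * (stF z u - stF z (v + b))) ((u - v) * stF z u)
      linarith)
  simp only [add_sub_cancel_left] at this
  rw [mul_comm a]; exact this

lemma Phi_dec {s t : ℝ} (ht : 1 ≤ t) (hs : t / 2 ≤ s) : |Φ s - Φ t| ≤ 8 / t ^ 2 * |s - t| := by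
  have := Convex.norm_image_sub_le_of_norm_hasDerivWithin_le (f := Φ) (f' := phiD)
    (s := Set.Ici (t / 2))
    (x := t) (y := s) (C := 8 / t ^ 2) (fun x _ => (Phi_hasDeriv x).hasDerivWithinAt)
    (fun x hx => by
      rw [Real.norm_eq_abs, abs_of_pos (phiD_pos x)]
      refine (phiD_le x).trans ?_
      have hx : t / 2 ≤ x := hx
      have h1 : -x ^ 2 / 2 ≤ -(t ^ 2 / 8) := by nlinarith
      refine (Real.exp_le_exp.2 h1).trans ?_
      rw [Real.exp_neg, ← one_div, div_le_div_iff₀ (Real.exp_pos _) (by positivity)]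
      have := Real.add_one_le_exp (t ^ 2 / 8)
      nlinarith)
    (convex_Ici _) (Set.mem_Ici.2 (by linarith)) (Set.mem_Ici.2 hs)
  simpa using this

lemma Phi_tail {z : ℝ} (hz : 0 < z) : 1 - Φ z ≤ 8 / z ^ 4 := by
  have h1 := mills_one hz.le
  rw [le_div_iff₀ (by positivity)]
  have h2 := Real.quadratic_le_exp_of_nonneg (x := z ^ 2 / 2) (by positivity)
  have h3 : z ^ 4 / 8 ≤ Real.exp (z ^ 2 / 2) := by nlinarith [sq_nonneg z]
  nlinarith [Phi_le_one z]

/-- truncated cube `x² min(1,|x|)` -/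
def psi (x : ℝ) : ℝ := x ^ 2 * min 1 |x|

lemma psi_nonneg (x : ℝ) : 0 ≤ psi x := by unfold psi; positivity
lemma psi_le_sq (x : ℝ) : psi x ≤ x ^ 2 := by
  unfold psi; exact mul_le_of_le_one_right (sq_nonneg x) (min_le_left _ _)
lemma psi_meas : Measurable psi := by unfold psi; fun_prop

lemma clip_mono (r c : ℝ) : Monotone (fun v : ℝ => max (-r) (min r (v - c))) := by
  intro x y h
  dsimp only
  gcongr

lemma clip_pw {a b δ V y : ℝ} (hδ : 0 ≤ δ) (ha : a ≤ V) (hb : V ≤ b) :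
    |y| * min δ |y| ≤ y * (max (-((b - a) / 2 + δ)) (min ((b - a) / 2 + δ) (V - (a + b) / 2))
      - max (-((b - a) / 2 + δ)) (min ((b - a) / 2 + δ) (V - y - (a + b) / 2))) := by
  have e1 : max (-((b - a) / 2 + δ)) (min ((b - a) / 2 + δ) (V - (a + b) / 2)) = V - (a + b) / 2 := by
    rw [min_eq_right (by linarith), max_eq_right (by linarith)]
  rw [e1]
  rcases le_total 0 y with hy | hy
  · rw [abs_of_nonneg hy]
    apply mul_le_mul_of_nonneg_left _ hy
    rw [min_eq_right (by linarith : V - y - (a + b) / 2 ≤ (b - a) / 2 + δ)]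
    rcases max_choice (-((b - a) / 2 + δ)) (V - y - (a + b) / 2) with h | h <;> rw [h]
    · exact (min_le_left _ _).trans (by linarith)
    · exact (min_le_right _ _).trans (by linarith)
  · rw [abs_of_nonpos hy, ← neg_mul_neg y]
    apply mul_le_mul_of_nonneg_left _ (by linarith)
    rcases min_choice ((b - a) / 2 + δ) (V - y - (a + b) / 2) with h | h
    · rw [h, max_eq_right (by linarith)]
      exact (min_le_left _ _).trans (by linarith)
    · rw [h, max_eq_right (by linarith)]
      exact (min_le_right _ _).trans (by linarith)

section
variable {Ω : Type*} [MeasurableSpace Ω] (μ : Measure Ω) [IsProbabilityMeasure μ]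

/-- i.i.d. sample law -/
abbrev Pn (n : ℕ) : Measure (Fin n → Ω) := Measure.pi (fun _ : Fin n => μ)

lemma peel {n : ℕ} (i : Fin (n + 1)) (F : Ω × (Fin n → Ω) → ℝ) :
    ∫ ω, F (ω i, fun j => ω (i.succAbove j)) ∂(Pn μ (n + 1)) = ∫ p, F p ∂(μ.prod (Pn μ n)) := by
  exact (measurePreserving_piFinSuccAbove (fun _ : Fin (n + 1) => μ) i).integral_comp' F

variable {μ}

lemma integrable_ev {n : ℕ} {h : Ω → ℝ} (hh : Integrable h μ) (i : Fin n) :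
    Integrable (fun ω : Fin n → Ω => h (ω i)) (Pn μ n) :=
  integrable_comp_eval (μ := fun _ : Fin n => μ) hh

lemma integral_ev {n : ℕ} {h : Ω → ℝ} (hh : Integrable h μ) (i : Fin n) :
    ∫ ω : Fin n → Ω, h (ω i) ∂(Pn μ n) = ∫ x, h x ∂μ :=
  integral_comp_eval (μ := fun _ : Fin n => μ) hh.1

lemma memLp_sum {n : ℕ} {h : Ω → ℝ} (hh : MemLp h 2 μ) :
    MemLp (fun ω : Fin n → Ω => ∑ i, h (ω i)) 2 (Pn μ n) := by
  refine memLp_finsetSum _ (fun i _ => ?_)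
  exact hh.comp_measurePreserving (measurePreserving_eval (fun _ : Fin n => μ) i)

lemma integral_sum {n : ℕ} {h : Ω → ℝ} (hh : Integrable h μ) :
    ∫ ω : Fin n → Ω, ∑ i, h (ω i) ∂(Pn μ n) = n * ∫ x, h x ∂μ := by
  rw [integral_finsetSum _ (fun i _ => integrable_ev hh i)]
  simp_rw [integral_ev hh]
  simp

lemma var_sum {n : ℕ} {h : Ω → ℝ} (hh : MemLp h 2 μ) :
    Var[fun ω : Fin n → Ω => ∑ i, h (ω i); Pn μ n] = n * Var[h; μ] := by
  have := variance_sum_pi (μ := fun _ : Fin n => μ) (X := fun _ => h) (fun _ => hh)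
  have e : (∑ i : Fin n, fun ω : Fin n → Ω => h (ω i)) = fun ω => ∑ i, h (ω i) := by
    funext ω; simp
  rw [e] at this
  rw [this]; simp

lemma sq_sum {n : ℕ} {h : Ω → ℝ} (hh : MemLp h 2 μ) (h0 : ∫ x, h x ∂μ = 0) :
    ∫ ω : Fin n → Ω, (∑ i, h (ω i)) ^ 2 ∂(Pn μ n) = n * ∫ x, h x ^ 2 ∂μ := by
  rw [← variance_of_integral_eq_zero hh.1.aemeasurable h0, ← var_sum hh,
    variance_of_integral_eq_zero (memLp_sum hh).1.aemeasurable]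
  rw [integral_sum (hh.integrable (by norm_num)), h0, mul_zero]

lemma abs_sum_le {n : ℕ} {g : Ω → ℝ} (hg : MemLp g 2 μ) (h0 : ∫ x, g x ∂μ = 0)
    (hs : n * ∫ x, g x ^ 2 ∂μ ≤ 1) : ∫ ω : Fin n → Ω, |∑ i, g (ω i)| ∂(Pn μ n) ≤ 1 := by
  have hWL : MemLp (fun ω : Fin n → Ω => ∑ i, g (ω i)) 2 (Pn μ n) := memLp_sum hg
  have h1 : ∫ ω : Fin n → Ω, |∑ i, g (ω i)| ∂(Pn μ n)
      ≤ ∫ ω : Fin n → Ω, (1 / 2 + (∑ i, g (ω i)) ^ 2 / 2) ∂(Pn μ n) := by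
    refine integral_mono (hWL.integrable (by norm_num)).abs
      ((integrable_const _).add (hWL.integrable_sq.div_const _)) (fun ω => ?_)
    simp only; rw [← sq_abs]; nlinarith [sq_nonneg (|∑ i, g (ω i)| - 1)]
  rw [integral_add (integrable_const _) (hWL.integrable_sq.div_const _)] at h1
  simp only [integral_const, probReal_univ, smul_eq_mul, one_mul] at h1
  rw [integral_div, sq_sum hg h0] at h1
  linarith

lemma conc {n : ℕ} {g : Ω → ℝ} (hm : Measurable g) (hg : MemLp g 2 μ) (h0 : ∫ x, g x ∂μ = 0)
    (hs : n * ∫ x, g x ^ 2 ∂μ ≤ 1) (hs' : 1 / 2 ≤ n * ∫ x, g x ^ 2 ∂μ) {δ : ℝ} (hδ : 0 < δ)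
    (hδ1 : δ ≤ 1) (hγ : n * ∫ x, psi (g x) ∂μ ≤ δ / 4) {a b : ℝ} (hab : a ≤ b) :
    (Pn μ n).real {ω | a ≤ ∑ i, g (ω i) ∧ ∑ i, g (ω i) ≤ b} ≤ 2 * (b - a) + 8 * δ := by
  obtain _ | k := n
  · norm_num at hs'
  set n := k + 1 with hn
  set W : (Fin n → Ω) → ℝ := fun ω => ∑ i, g (ω i) with hW
  have hWm : Measurable W := by
    rw [hW]; exact Finset.measurable_sum _ (fun i _ => hm.comp (measurable_pi_apply i))
  set r := (b - a) / 2 + δ with hr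
  have hr0 : 0 ≤ r := by rw [hr]; linarith
  set f : ℝ → ℝ := fun v => max (-r) (min r (v - (a + b) / 2)) with hf
  have hfm : Measurable f := by rw [hf]; fun_prop
  have hfb : ∀ v, |f v| ≤ r := by
    intro v; rw [abs_le]; simp only [hf]
    exact ⟨le_max_left _ _, max_le (by linarith) (min_le_left _ _)⟩
  have hgi : Integrable g μ := hg.integrable (by norm_num)
  have hg2 : Integrable (fun x => g x ^ 2) μ := hg.integrable_sq
  set q : Ω → ℝ := fun x => |g x| * min δ |g x| with hq
  have hqm : Measurable q := by rw [hq]; fun_prop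
  have hq0 : ∀ x, 0 ≤ q x := fun x => mul_nonneg (abs_nonneg _) (le_min hδ.le (abs_nonneg _))
  have hqg : ∀ x, q x ≤ g x ^ 2 := by
    intro x; rw [← sq_abs, sq]
    exact mul_le_mul_of_nonneg_left (min_le_right _ _) (abs_nonneg _)
  have hqd : ∀ x, q x ≤ δ * |g x| := by
    intro x
    have := mul_le_mul_of_nonneg_left (min_le_left δ |g x|) (abs_nonneg (g x))
    simp only [hq]; linarith
  have hq2 : ∀ x, q x ^ 2 ≤ δ ^ 2 * g x ^ 2 := by
    intro x
    rw [← sq_abs (g x), ← mul_pow]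
    exact pow_le_pow_left₀ (hq0 x) (hqd x) 2
  have hqL : MemLp q 2 μ := by
    rw [memLp_two_iff_integrable_sq hqm.aestronglyMeasurable]
    refine (hg2.const_mul (δ ^ 2)).mono' (by fun_prop) (Eventually.of_forall fun x => ?_)
    rw [Real.norm_eq_abs, abs_of_nonneg (sq_nonneg _)]; exact hq2 x
  have hqi : Integrable q μ := hqL.integrable (by norm_num)
  have hpsi : Integrable (fun x => psi (g x)) μ := by
    refine hg2.mono' (psi_meas.comp hm).aestronglyMeasurable (Eventually.of_forall fun x => ?_)
    rw [Real.norm_eq_abs, abs_of_nonneg (psi_nonneg _)]; exact psi_le_sq _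
  set M : (Fin n → Ω) → ℝ := fun ω => ∑ i, q (ω i) with hM
  have hMm : Measurable M := by
    rw [hM]; exact Finset.measurable_sum _ (fun i _ => hqm.comp (measurable_pi_apply i))
  have hML : MemLp M 2 (Pn μ n) := memLp_sum hqL
  have hMi : Integrable M (Pn μ n) := hML.integrable (by norm_num)
  set E := ∫ ω, M ω ∂(Pn μ n) with hE
  have hE4 : 1 / 4 ≤ E := by
    rw [hE, hM, integral_sum hqi]
    have : ∫ x, g x ^ 2 - psi (g x) / δ ∂μ ≤ ∫ x, q x ∂μ := by
      refine integral_mono (hg2.sub (hpsi.div_const _)) hqi (fun x => ?_)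
      simp only [hq, psi]
      rw [← sq_abs (g x)]
      have hx := abs_nonneg (g x)
      set y := |g x|
      rcases le_total y δ with h | h
      · rw [min_eq_right h]
        have : 0 ≤ y ^ 2 * min 1 y / δ := by positivity
        nlinarith
      · have : y ^ 2 ≤ y ^ 2 * min 1 y / δ := by
          rw [le_div_iff₀ hδ]
          exact mul_le_mul_of_nonneg_left (le_min hδ1 h) (sq_nonneg y)
        have : 0 ≤ y * min δ y := mul_nonneg hx (le_min hδ.le hx)
        linarith
    rw [integral_sub hg2 (hpsi.div_const _), integral_div] at this
    have hn0 : (0:ℝ) ≤ n := Nat.cast_nonneg n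
    have h2 := mul_le_mul_of_nonneg_left this hn0
    have h3 : n * (∫ x, psi (g x) ∂μ) / δ ≤ 1 / 4 := by
      rw [div_le_iff₀ hδ]; linarith
    have h4 : n * ((∫ x, g x ^ 2 ∂μ) - (∫ x, psi (g x) ∂μ) / δ)
      = n * (∫ x, g x ^ 2 ∂μ) - n * (∫ x, psi (g x) ∂μ) / δ := by ring
    linarith
  have hMdev : ∫ ω, |M ω - E| ∂(Pn μ n) ≤ δ := by
    have hv : Var[M; Pn μ n] ≤ δ ^ 2 := by
      rw [hM, var_sum hqL]
      have h1 : Var[q; μ] ≤ ∫ x, q x ^ 2 ∂μ := by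
        have := variance_le_expectation_sq (μ := μ) (X := q) hqm.aestronglyMeasurable
        simpa using this
      have h2 : ∫ x, q x ^ 2 ∂μ ≤ δ ^ 2 * ∫ x, g x ^ 2 ∂μ := by
        rw [← integral_const_mul]
        exact integral_mono hqL.integrable_sq (hg2.const_mul _) hq2
      have hn0 : (0:ℝ) ≤ n := Nat.cast_nonneg n
      calc (n:ℝ) * Var[q; μ] ≤ n * (δ ^ 2 * ∫ x, g x ^ 2 ∂μ) := by gcongr; linarith
        _ = δ ^ 2 * (n * ∫ x, g x ^ 2 ∂μ) := by ring
        _ ≤ δ ^ 2 * 1 := by gcongr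
        _ = δ ^ 2 := by ring
    rw [variance_eq_integral hMm.aemeasurable] at hv
    have hL : MemLp (fun ω => M ω - E) 2 (Pn μ n) := hML.sub (memLp_const E)
    have : ∫ ω, |M ω - E| ∂(Pn μ n) ≤ ∫ ω, (δ / 2 + (M ω - E) ^ 2 / (2 * δ)) ∂(Pn μ n) := by
      refine integral_mono (hL.integrable (by norm_num)).abs
        ((integrable_const _).add (hL.integrable_sq.div_const _)) (fun ω => ?_)
      simp only
      rw [← sq_abs]
      have : δ / 2 + |M ω - E| ^ 2 / (2 * δ) - |M ω - E| = (|M ω - E| - δ) ^ 2 / (2 * δ) := by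
        field_simp; ring
      have h2 : 0 ≤ (|M ω - E| - δ) ^ 2 / (2 * δ) := by positivity
      linarith
    rw [integral_add (integrable_const _) (hL.integrable_sq.div_const _)] at this
    simp only [integral_const, probReal_univ, smul_eq_mul, one_mul] at this
    rw [integral_div] at this
    have h3 : (∫ ω, (M ω - E) ^ 2 ∂(Pn μ n)) / (2 * δ) ≤ δ / 2 := by
      rw [div_le_iff₀ (by positivity)]; nlinarith
    linarith
  have hWL : MemLp W 2 (Pn μ n) := memLp_sum hg
  have hWi : Integrable W (Pn μ n) := hWL.integrable (by norm_num)
  have hW1 : ∫ ω, |W ω| ∂(Pn μ n) ≤ 1 := abs_sum_le hg h0 hs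
  -- upper bound
  have hfWm : Measurable fun ω => f (W ω) := hfm.comp hWm
  have hup : ∫ ω, W ω * f (W ω) ∂(Pn μ n) ≤ r := by
    have : ∫ ω, W ω * f (W ω) ∂(Pn μ n) ≤ ∫ ω, |W ω| * r ∂(Pn μ n) := by
      refine integral_mono (hWi.mul_bdd (c := r) hfWm.aestronglyMeasurable
        (Eventually.of_forall fun ω => hfb _)) (hWi.abs.mul_const r) (fun ω => ?_)
      calc W ω * f (W ω) ≤ |W ω * f (W ω)| := le_abs_self _
        _ = |W ω| * |f (W ω)| := abs_mul _ _
        _ ≤ |W ω| * r := mul_le_mul_of_nonneg_left (hfb _) (abs_nonneg _)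
    rw [integral_mul_const] at this
    nlinarith
  -- leave one out
  have hgev : ∀ i : Fin n, Integrable (fun ω : Fin n → Ω => g (ω i)) (Pn μ n) := integrable_ev hgi
  have hm1 : ∀ i : Fin n, Measurable fun ω : Fin n → Ω => f (W ω - g (ω i)) := fun i =>
    hfm.comp (hWm.sub (hm.comp (measurable_pi_apply i)))
  have hz : ∀ i : Fin n, ∫ ω, g (ω i) * f (W ω - g (ω i)) ∂(Pn μ n) = 0 := by
    intro i
    have e := peel μ i (fun p => g p.1 * f (∑ j, g (p.2 j)))
    rw [integral_prod_mul g (fun y : Fin k → Ω => f (∑ j, g (y j))), h0, zero_mul] at e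
    rw [← e]
    congr 1; funext ω
    simp only [hW]
    rw [Fin.sum_univ_succAbove _ i]; simp
  have hI1 : ∀ i : Fin n, Integrable (fun ω : Fin n → Ω => g (ω i) * f (W ω)) (Pn μ n) := fun i =>
    (hgev i).mul_bdd (c := r) hfWm.aestronglyMeasurable (Eventually.of_forall fun ω => hfb _)
  have hI2 : ∀ i : Fin n, Integrable (fun ω : Fin n → Ω => g (ω i) * f (W ω - g (ω i))) (Pn μ n) :=
    fun i => (hgev i).mul_bdd (c := r) (hm1 i).aestronglyMeasurable
      (Eventually.of_forall fun ω => hfb _)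
  have hI3 : ∀ i : Fin n, Integrable
      (fun ω : Fin n → Ω => g (ω i) * f (W ω) - g (ω i) * f (W ω - g (ω i))) (Pn μ n) :=
    fun i => (hI1 i).sub (hI2 i)
  have heq : ∫ ω, W ω * f (W ω) ∂(Pn μ n)
      = ∫ ω, ∑ i, (g (ω i) * f (W ω) - g (ω i) * f (W ω - g (ω i))) ∂(Pn μ n) := by
    rw [integral_finsetSum _ (fun i _ => hI3 i)]
    have : ∀ i : Fin n, ∫ ω, (g (ω i) * f (W ω) - g (ω i) * f (W ω - g (ω i))) ∂(Pn μ n)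
        = ∫ ω, g (ω i) * f (W ω) ∂(Pn μ n) := by
      intro i; rw [integral_sub (hI1 i) (hI2 i), hz i, sub_zero]
    simp_rw [this]
    rw [← integral_finsetSum _ (fun i _ => hI1 i)]
    congr 1; funext ω
    simp only [hW]
    rw [Finset.sum_mul]
  set A : Set (Fin n → Ω) := {ω | a ≤ W ω ∧ W ω ≤ b} with hA
  have hAm : MeasurableSet A :=
    (measurableSet_le measurable_const hWm).inter (measurableSet_le hWm measurable_const)
  have hI4 : Integrable (fun ω => |M ω - E|) (Pn μ n) := (hMi.sub (integrable_const E)).abs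
  have hlow : ∫ ω, A.indicator (fun _ => (1:ℝ)) ω * E - |M ω - E| ∂(Pn μ n)
      ≤ ∫ ω, W ω * f (W ω) ∂(Pn μ n) := by
    rw [heq]
    refine integral_mono ((((integrable_const 1).indicator hAm).mul_const E).sub
      hI4) (integrable_finsetSum _ fun i _ => hI3 i)
      (fun ω => ?_)
    simp only
    by_cases hω : ω ∈ A
    · rw [Set.indicator_of_mem hω, one_mul]
      have h1 : M ω ≤ ∑ i, (g (ω i) * f (W ω) - g (ω i) * f (W ω - g (ω i))) := by
        simp only [hM]
        refine Finset.sum_le_sum fun i _ => ?_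
        rw [← mul_sub]
        exact clip_pw hδ.le hω.1 hω.2
      have h2 := neg_abs_le (M ω - E)
      linarith
    · rw [Set.indicator_of_notMem hω, zero_mul]
      have h1 : 0 ≤ ∑ i, (g (ω i) * f (W ω) - g (ω i) * f (W ω - g (ω i))) := by
        refine Finset.sum_nonneg fun i _ => ?_
        rw [← mul_sub]
        rcases le_total 0 (g (ω i)) with h | h
        · refine mul_nonneg h (sub_nonneg.2 (clip_mono r _ ?_)); linarith
        · refine mul_nonneg_of_nonpos_of_nonpos h (sub_nonpos.2 (clip_mono r _ ?_)); linarith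
      linarith [abs_nonneg (M ω - E)]
  rw [integral_sub (((integrable_const 1).indicator hAm).mul_const E)
    hI4, integral_mul_const, integral_indicator hAm] at hlow
  simp only [integral_const, smul_eq_mul, mul_one, measureReal_restrict_apply_univ] at hlow
  have hp : 0 ≤ (Pn μ n).real A := measureReal_nonneg
  have : (Pn μ n).real A * (1 / 4) ≤ (Pn μ n).real A * E := mul_le_mul_of_nonneg_left hE4 hp
  have hr' : r = (b - a) / 2 + δ := hr
  linarith

end

section
variable {Ω : Type*} [MeasurableSpace Ω] {μ : Measure Ω} [IsProbabilityMeasure μ]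

lemma psi_cross (a b : ℝ) : a ^ 2 * min 1 |b| ≤ psi a + psi b := by
  have h1 := psi_nonneg a
  have h2 := psi_nonneg b
  unfold psi at *
  rcases le_total |a| |b| with h | h
  · have : a ^ 2 * min 1 |b| ≤ b ^ 2 * min 1 |b| := by
      apply mul_le_mul_of_nonneg_right (sq_le_sq.2 h)
      exact le_min zero_le_one (abs_nonneg _)
    linarith
  · have : a ^ 2 * min 1 |b| ≤ a ^ 2 * min 1 |a| := by gcongr
    linarith

/-- pointwise (in the two leave-out variables) Stein estimate, integrated over the rest -/
lemma stein_inner {n : ℕ} {g : Ω → ℝ} (hm : Measurable g) (hg : MemLp g 2 μ)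
    (h0 : ∫ x, g x ∂μ = 0)
    (hs : n * ∫ x, g x ^ 2 ∂μ ≤ 1) (hs' : 1 / 2 ≤ n * ∫ x, g x ^ 2 ∂μ) {δ : ℝ} (hδ : 0 < δ)
    (hδ1 : δ ≤ 1) (hγ : n * ∫ x, psi (g x) ∂μ ≤ δ / 4) (z a b : ℝ) :
    |(∫ v : Fin n → Ω, a * (stF z ((∑ i, g (v i)) + a) - stF z (∑ i, g (v i))) ∂(Pn μ n))
      - a ^ 2 * ∫ v : Fin n → Ω, stD z ((∑ i, g (v i)) + b) ∂(Pn μ n)|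
      ≤ 140 * psi a + 70 * psi b + 112 * δ * a ^ 2 := by
  set W : (Fin n → Ω) → ℝ := fun ω => ∑ i, g (ω i) with hW
  have hWm : Measurable W := by
    rw [hW]; exact Finset.measurable_sum _ (fun i _ => hm.comp (measurable_pi_apply i))
  have hWi : Integrable W (Pn μ n) := (memLp_sum hg).integrable (by norm_num)
  have hW1 : ∫ ω, |W ω| ∂(Pn μ n) ≤ 1 := abs_sum_le hg h0 hs
  have hD : Integrable (fun v => stD z (W v + b)) (Pn μ n) := by
    refine (integrable_const (7:ℝ)).mono' ((stD_meas z).comp (hWm.add_const b)).aestronglyMeasurable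
      (Eventually.of_forall fun v => stD_abs z _)
  have hF : Integrable (fun v => a * (stF z (W v + a) - stF z (W v))) (Pn μ n) := by
    refine Integrable.const_mul ?_ a
    refine (integrable_const (7 * |a|)).mono'
      (((stF_meas z).comp (hWm.add_const a)).sub ((stF_meas z).comp hWm)).aestronglyMeasurable
      (Eventually.of_forall fun v => ?_)
    have := stF_lip z (W v) (W v + a)
    simpa using this
  have e : (∫ v, a * (stF z (W v + a) - stF z (W v)) ∂(Pn μ n))
      - a ^ 2 * ∫ v, stD z (W v + b) ∂(Pn μ n)
      = ∫ v, a * (stF z (W v + a) - stF z (W v) - a * stD z (W v + b)) ∂(Pn μ n) := by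
    rw [← integral_const_mul, ← integral_sub hF (hD.const_mul _)]
    congr 1; funext v; ring
  rw [e]
  have b1 : |∫ v, a * (stF z (W v + a) - stF z (W v) - a * stD z (W v + b)) ∂(Pn μ n)|
      ≤ 14 * a ^ 2 := by
    have := norm_integral_le_of_norm_le (μ := Pn μ n) (g := fun _ => 14 * a ^ 2)
      (f := fun v => a * (stF z (W v + a) - stF z (W v) - a * stD z (W v + b)))
      (integrable_const _) (Eventually.of_forall fun v => by
        rw [Real.norm_eq_abs, abs_mul, ← sq_abs]
        nlinarith [stein_pw1 z (W v) a b, abs_nonneg a])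
    simpa using this
  set t := |a| + |b| with ht
  have ht0 : 0 ≤ t := by positivity
  set A : Set (Fin n → Ω) := {ω | z - t ≤ W ω ∧ W ω ≤ z + t} with hA
  have hAm : MeasurableSet A :=
    (measurableSet_le measurable_const hWm).inter (measurableSet_le hWm measurable_const)
  have hc : (Pn μ n).real A ≤ 4 * t + 8 * δ := by
    have := conc hm hg h0 hs hs' hδ hδ1 hγ (a := z - t) (b := z + t) (by linarith)
    linarith
  have b2 : |∫ v, a * (stF z (W v + a) - stF z (W v) - a * stD z (W v + b)) ∂(Pn μ n)|
      ≤ a ^ 2 * (70 * t + 112 * δ) := by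
    have hi1 : Integrable (fun v => (7 * t) * (|W v| + 1)) (Pn μ n) :=
      (hWi.abs.add (integrable_const 1)).const_mul _
    have hi2 : Integrable (fun v => A.indicator (fun _ => (14:ℝ)) v) (Pn μ n) :=
      (integrable_const _).indicator hAm
    have := norm_integral_le_of_norm_le (μ := Pn μ n)
      (g := fun v => a ^ 2 * ((7 * t) * (|W v| + 1) + A.indicator (fun _ => (14:ℝ)) v))
      (f := fun v => a * (stF z (W v + a) - stF z (W v) - a * stD z (W v + b)))
      ((hi1.add hi2).const_mul _) (Eventually.of_forall fun v => by
        rw [Real.norm_eq_abs, abs_mul, ← sq_abs a]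
        have ha := abs_nonneg a
        have h1 : 0 ≤ (7 * t) * (|W v| + 1) := by positivity
        by_cases hv : v ∈ A
        · rw [Set.indicator_of_mem hv]
          have := stein_pw1 z (W v) a b
          have h2 : 14 * |a| ≤ |a| * ((7 * t) * (|W v| + 1) + 14) := by nlinarith
          calc _ ≤ |a| * (|a| * ((7 * t) * (|W v| + 1) + 14)) :=
                mul_le_mul_of_nonneg_left (this.trans h2) ha
            _ = _ := by ring
        · rw [Set.indicator_of_notMem hv]
          have hlt : t < |W v - z| := by
            by_contra hcon
            rw [not_lt, abs_le] at hcon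
            exact hv ⟨by linarith, by linarith⟩
          have := stein_pw2 z (W v) a b hlt
          calc _ ≤ |a| * (7 * ((|W v| + 1) * t) * |a|) := mul_le_mul_of_nonneg_left this ha
            _ = _ := by ring)
    rw [integral_const_mul (a ^ 2), integral_add hi1 hi2, integral_const_mul (7 * t),
      integral_add hWi.abs (integrable_const 1), integral_indicator hAm] at this
    simp only [integral_const, smul_eq_mul, measureReal_restrict_apply_univ, probReal_univ,
      mul_one] at this
    refine this.trans (mul_le_mul_of_nonneg_left ?_ (sq_nonneg a))
    nlinarith
  -- combine
  have p1 : a ^ 2 * min 1 |a| = psi a := rfl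
  have p2 := psi_cross a b
  have ha2 := sq_nonneg a
  have p3 := psi_nonneg a
  have p4 := psi_nonneg b
  by_cases h1 : 1 ≤ |a| ∨ 1 ≤ |b|
  · have : a ^ 2 ≤ psi a + psi b := by
      rcases h1 with h | h
      · rw [min_eq_left h] at p1; linarith
      · rw [min_eq_left h] at p2; linarith
    have h5 : 0 ≤ 112 * δ * a ^ 2 := by positivity
    linarith
  · push Not at h1
    rw [min_eq_right h1.1.le] at p1
    rw [min_eq_right h1.2.le] at p2
    calc _ ≤ a ^ 2 * (70 * t + 112 * δ) := b2
      _ = 70 * (a ^ 2 * |a|) + 70 * (a ^ 2 * |b|) + 112 * δ * a ^ 2 := by rw [ht]; ring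
      _ ≤ _ := by linarith

lemma berry_esseen {n : ℕ} (hn : 1 ≤ n) {g : Ω → ℝ} (hm : Measurable g) (hg : MemLp g 2 μ)
    (h0 : ∫ x, g x ∂μ = 0) (hs : ((n + 1 : ℕ) : ℝ) * ∫ x, g x ^ 2 ∂μ = 1) {Γ : ℝ} (hΓ0 : 0 < Γ)
    (hΓ : ((n + 1 : ℕ) : ℝ) * ∫ x, psi (g x) ∂μ ≤ Γ) (z : ℝ) :
    |(Pn μ (n + 1)).real {ω | ∑ i, g (ω i) ≤ z} - Φ z| ≤ 700 * Γ := by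
  have hg2 : Integrable (fun x => g x ^ 2) μ := hg.integrable_sq
  have hgi : Integrable g μ := hg.integrable (by norm_num)
  have hpsi : Integrable (fun x => psi (g x)) μ := by
    refine hg2.mono' (psi_meas.comp hm).aestronglyMeasurable (Eventually.of_forall fun x => ?_)
    rw [Real.norm_eq_abs, abs_of_nonneg (psi_nonneg _)]; exact psi_le_sq _
  set G := ∫ x, g x ^ 2 ∂μ with hG
  set Q := ∫ x, psi (g x) ∂μ with hQ
  have hG0 : 0 ≤ G := integral_nonneg fun x => sq_nonneg _
  have hQ0 : 0 ≤ Q := integral_nonneg fun x => psi_nonneg _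
  set m : ℝ := ((n + 1 : ℕ) : ℝ) with hmdef
  have hmn : m = n + 1 := by rw [hmdef]; push_cast; ring
  have hn1 : (1:ℝ) ≤ n := by exact_mod_cast hn
  rcases le_or_gt (4 * Γ) 1 with hsm | hbig
  swap
  · have h1 : (Pn μ (n + 1)).real {ω | ∑ i, g (ω i) ≤ z} ≤ 1 := measureReal_le_one
    have h2 : 0 ≤ (Pn μ (n + 1)).real {ω | ∑ i, g (ω i) ≤ z} := measureReal_nonneg
    have h3 := Phi_nonneg z
    have h4 := Phi_le_one z
    rw [abs_le]; constructor <;> linarith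
  have hsn : n * G ≤ 1 := by nlinarith
  have hsn' : 1 / 2 ≤ n * G := by nlinarith
  have hγ : n * Q ≤ (4 * Γ) / 4 := by nlinarith
  set W : (Fin (n + 1) → Ω) → ℝ := fun ω => ∑ i, g (ω i) with hW
  have hWm : Measurable W := by
    rw [hW]; exact Finset.measurable_sum _ (fun i _ => hm.comp (measurable_pi_apply i))
  have hWi : Integrable W (Pn μ (n + 1)) := (memLp_sum hg).integrable (by norm_num)
  set V : (Fin n → Ω) → ℝ := fun ω => ∑ i, g (ω i) with hV
  have hVm : Measurable V := by
    rw [hV]; exact Finset.measurable_sum _ (fun i _ => hm.comp (measurable_pi_apply i))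
  have hWF : Integrable (fun ω => W ω * stF z (W ω)) (Pn μ (n + 1)) :=
    hWi.mul_bdd (c := 6) ((stF_meas z).comp hWm).aestronglyMeasurable
      (Eventually.of_forall fun ω => stF_abs z _)
  -- Stein equation
  have st1 : (Pn μ (n + 1)).real {ω | W ω ≤ z} - Φ z
      = ∫ ω, stD z (W ω) ∂(Pn μ (n + 1)) - ∫ ω, W ω * stF z (W ω) ∂(Pn μ (n + 1)) := by
    have hD : Integrable (fun ω => stD z (W ω)) (Pn μ (n + 1)) := by
      refine (integrable_const (7:ℝ)).mono' ((stD_meas z).comp hWm).aestronglyMeasurable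
        (Eventually.of_forall fun v => stD_abs z _)
    rw [← integral_sub hD hWF]
    have hset : MeasurableSet {ω | W ω ≤ z} := measurableSet_le hWm measurable_const
    have : ∀ ω, stD z (W ω) - W ω * stF z (W ω)
        = ({ω | W ω ≤ z} : Set _).indicator (fun _ => (1:ℝ)) ω - Φ z := by
      intro ω
      simp only [stD, Set.indicator, Set.mem_setOf_eq]; ring
    simp_rw [this]
    rw [integral_sub ((integrable_const _).indicator hset) (integrable_const _),
      integral_indicator hset]
    simp
  -- E D(W)
  have hDp : Integrable (fun p : Ω × (Fin n → Ω) => stD z (V p.2 + g p.1)) (μ.prod (Pn μ n)) := by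
    refine (integrable_const (7:ℝ)).mono' ((stD_meas z).comp
      ((hVm.comp measurable_snd).add (hm.comp measurable_fst))).aestronglyMeasurable
        (Eventually.of_forall fun v => stD_abs z _)
  have st2 : ∫ ω, stD z (W ω) ∂(Pn μ (n + 1))
      = ∫ x, ∫ v, stD z (V v + g x) ∂(Pn μ n) ∂μ := by
    rw [← integral_prod _ hDp, ← peel μ 0 (fun p => stD z (V p.2 + g p.1))]
    congr 1; funext ω
    simp only [hW, hV]
    rw [Fin.sum_univ_succAbove _ 0, add_comm]
  have hmF : Measurable (fun p : Ω × (Fin n → Ω) => stF z (V p.2 + g p.1)) :=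
    (stF_meas z).comp ((hVm.comp measurable_snd).add (hm.comp measurable_fst))
  have hmF2 : Measurable (fun p : Ω × (Fin n → Ω) => stF z (V p.2)) :=
    (stF_meas z).comp (hVm.comp measurable_snd)
  have hgp : Integrable (fun p : Ω × (Fin n → Ω) => g p.1) (μ.prod (Pn μ n)) :=
    hgi.comp_fst _
  have hF1 : Integrable (fun p : Ω × (Fin n → Ω) => g p.1 * stF z (V p.2 + g p.1))
      (μ.prod (Pn μ n)) := hgp.mul_bdd (c := 6) hmF.aestronglyMeasurable
        (Eventually.of_forall fun ω => stF_abs z _)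
  have hF2 : Integrable (fun p : Ω × (Fin n → Ω) => g p.1 * stF z (V p.2))
      (μ.prod (Pn μ n)) := hgp.mul_bdd (c := 6) hmF2.aestronglyMeasurable
        (Eventually.of_forall fun ω => stF_abs z _)
  have hF3 : Integrable (fun p : Ω × (Fin n → Ω) => g p.1 * (stF z (V p.2 + g p.1) - stF z (V p.2)))
      (μ.prod (Pn μ n)) := by
    refine (hF1.sub hF2).congr (Eventually.of_forall fun p => ?_)
    simp only [Pi.sub_apply]; ring
  have st3 : ∫ ω, W ω * stF z (W ω) ∂(Pn μ (n + 1))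
      = m * ∫ x, ∫ v, g x * (stF z (V v + g x) - stF z (V v)) ∂(Pn μ n) ∂μ := by
    rw [← integral_prod _ hF3]
    have hz : ∫ p : Ω × (Fin n → Ω), g p.1 * stF z (V p.2) ∂(μ.prod (Pn μ n)) = 0 := by
      rw [integral_prod_mul g (fun v : Fin n → Ω => stF z (V v)), h0, zero_mul]
    have e1 : ∫ p : Ω × (Fin n → Ω), g p.1 * (stF z (V p.2 + g p.1) - stF z (V p.2)) ∂(μ.prod (Pn μ n))
        = ∫ p : Ω × (Fin n → Ω), g p.1 * stF z (V p.2 + g p.1) ∂(μ.prod (Pn μ n)) := by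
      simp_rw [mul_sub]
      rw [integral_sub hF1 hF2, hz, sub_zero]
    rw [e1]
    have e2 : ∀ i : Fin (n + 1), ∫ ω, g (ω i) * stF z (W ω) ∂(Pn μ (n + 1))
        = ∫ p : Ω × (Fin n → Ω), g p.1 * stF z (V p.2 + g p.1) ∂(μ.prod (Pn μ n)) := by
      intro i
      rw [← peel μ i (fun p => g p.1 * stF z (V p.2 + g p.1))]
      congr 1; funext ω
      simp only [hW, hV]
      rw [Fin.sum_univ_succAbove _ i, add_comm]
    have e3 : ∫ ω, W ω * stF z (W ω) ∂(Pn μ (n + 1))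
        = ∑ i : Fin (n + 1), ∫ ω, g (ω i) * stF z (W ω) ∂(Pn μ (n + 1)) := by
      rw [← integral_finsetSum]
      · congr 1; funext ω
        rw [← Finset.sum_mul]
      · intro i _
        exact (integrable_ev hgi i).mul_bdd (c := 6) ((stF_meas z).comp hWm).aestronglyMeasurable
          (Eventually.of_forall fun ω => stF_abs z _)
    rw [e3]; simp_rw [e2]; simp [hmdef]
  set A : Ω → ℝ := fun x => ∫ v, g x * (stF z (V v + g x) - stF z (V v)) ∂(Pn μ n) with hA
  set B : Ω → ℝ := fun x => ∫ v, stD z (V v + g x) ∂(Pn μ n) with hB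
  have hAi : Integrable A μ := hF3.integral_prod_left
  have hBi : Integrable B μ := hDp.integral_prod_left
  set δ := 4 * Γ with hδ
  have hin : ∀ x y, |A x - g x ^ 2 * B y| ≤ 140 * psi (g x) + 70 * psi (g y) + 112 * δ * g x ^ 2 :=
    fun x y => stein_inner hm hg h0 hsn hsn' (by positivity) hsm hγ z (g x) (g y)
  have hin2 : ∀ x, |A x - g x ^ 2 * ∫ y, B y ∂μ|
      ≤ 140 * psi (g x) + 70 * Q + 112 * δ * g x ^ 2 := by
    intro x
    have e : A x - g x ^ 2 * ∫ y, B y ∂μ = ∫ y, (A x - g x ^ 2 * B y) ∂μ := by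
      rw [integral_sub (integrable_const _) (hBi.const_mul _), integral_const_mul]
      simp
    rw [e]
    have := norm_integral_le_of_norm_le (μ := μ)
      (g := fun y => 140 * psi (g x) + 112 * δ * g x ^ 2 + 70 * psi (g y))
      (f := fun y => A x - g x ^ 2 * B y)
      ((integrable_const _).add (hpsi.const_mul 70)) (Eventually.of_forall fun y => by
        rw [Real.norm_eq_abs]; linarith [hin x y])
    rw [integral_add (integrable_const _) (hpsi.const_mul 70), integral_const_mul] at this
    simp only [integral_const, probReal_univ, smul_eq_mul, one_mul, Real.norm_eq_abs] at this
    linarith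
  have hfin : |∫ x, A x ∂μ - G * ∫ y, B y ∂μ| ≤ 210 * Q + 112 * δ * G := by
    have e : ∫ x, A x ∂μ - G * ∫ y, B y ∂μ = ∫ x, (A x - g x ^ 2 * ∫ y, B y ∂μ) ∂μ := by
      rw [integral_sub hAi (hg2.mul_const _), integral_mul_const]
    rw [e]
    have i1 : Integrable (fun x => 140 * psi (g x) + 70 * Q) μ :=
      (hpsi.const_mul 140).add (integrable_const _)
    have := norm_integral_le_of_norm_le (μ := μ)
      (g := fun x => 140 * psi (g x) + 70 * Q + 112 * δ * g x ^ 2)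
      (f := fun x => A x - g x ^ 2 * ∫ y, B y ∂μ)
      (i1.add (hg2.const_mul _)) (Eventually.of_forall fun y => by
        rw [Real.norm_eq_abs]; exact hin2 y)
    rw [integral_add i1 (hg2.const_mul _),
      integral_add (hpsi.const_mul 140) (integrable_const _),
      integral_const_mul 140, integral_const_mul (112 * δ)] at this
    simp only [integral_const, probReal_univ, smul_eq_mul, one_mul, Real.norm_eq_abs] at this
    linarith
  have hm0 : 0 < m := by rw [hmn]; linarith
  rw [st1, st2, st3]
  have e : (∫ x, B x ∂μ) - m * ∫ x, A x ∂μ = - m * (∫ x, A x ∂μ - G * ∫ y, B y ∂μ) := by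
    linear_combination -(∫ x, B x ∂μ) * hs
  change |(∫ x, B x ∂μ) - m * ∫ x, A x ∂μ| ≤ _
  rw [e, abs_mul, abs_neg, abs_of_pos hm0]
  calc m * |∫ x, A x ∂μ - G * ∫ y, B y ∂μ| ≤ m * (210 * Q + 112 * δ * G) := by gcongr
    _ = 210 * (m * Q) + 112 * δ * (m * G) := by ring
    _ ≤ 700 * Γ := by rw [hs]; linarith

end

/-- Standardised real law with bounded fourth moment. -/
structure Std4 (ν : Measure ℝ) (K : ℝ) : Prop where
  prob : IsProbabilityMeasure ν
  i4 : Integrable (fun x : ℝ => x ^ 4) ν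
  m1 : ∫ x : ℝ, x ∂ν = 0
  m2 : ∫ x : ℝ, x ^ 2 ∂ν = 1
  m4 : ∫ x : ℝ, x ^ 4 ∂ν ≤ K

section
variable {ν : Measure ℝ} {K : ℝ}

lemma Std4.i2 (h : Std4 ν K) : Integrable (fun x : ℝ => x ^ 2) ν := by
  by_contra hh
  have := h.m2
  rw [integral_undef hh] at this
  norm_num at this

lemma Std4.i3 (h : Std4 ν K) : Integrable (fun x : ℝ => |x| ^ 3) ν := by
  refine (h.i2.add h.i4).mono' (by fun_prop) (Eventually.of_forall fun x => ?_)
  simp only [Pi.add_apply]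
  rw [Real.norm_eq_abs, abs_of_nonneg (by positivity)]
  have : x ^ 2 = |x| ^ 2 := (sq_abs x).symm
  have h4 : x ^ 4 = |x| ^ 4 := by rw [show x ^ 4 = (x ^ 2) ^ 2 by ring, this]; ring
  rw [this, h4]
  nlinarith [sq_nonneg (|x| ^ 2 - |x|), sq_nonneg (|x|^2), sq_nonneg (|x|)]

lemma Std4.i3' (h : Std4 ν K) : Integrable (fun x : ℝ => x ^ 3) ν := by
  refine h.i3.mono' (by fun_prop) (Eventually.of_forall fun x => ?_)
  rw [Real.norm_eq_abs, abs_pow]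

lemma Std4.i1 (h : Std4 ν K) : Integrable (fun x : ℝ => x) ν := by
  have := h.prob
  refine ((integrable_const (1:ℝ)).add h.i2).mono' (by fun_prop) (Eventually.of_forall fun x => ?_)
  simp only [Pi.add_apply]
  rw [Real.norm_eq_abs, ← sq_abs x]
  nlinarith [sq_nonneg (|x| - 1)]

lemma Std4.w2 (h : Std4 ν K) : ∫ x : ℝ, (x ^ 2 - 1) ^ 2 ∂ν = ∫ x : ℝ, x ^ 4 ∂ν - 1 := by
  have := h.prob
  have e : ∀ x : ℝ, (x ^ 2 - 1) ^ 2 = (x ^ 4 - 2 * x ^ 2) + 1 := fun x => by ring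
  simp_rw [e]
  have i : Integrable (fun x : ℝ => x ^ 4 - 2 * x ^ 2) ν := h.i4.sub (h.i2.const_mul 2)
  rw [integral_add i (integrable_const _), integral_sub h.i4 (h.i2.const_mul 2),
    integral_const_mul, h.m2]
  simp; ring

lemma Std4.K1 (h : Std4 ν K) : 1 ≤ K := by
  have := h.w2
  have h0 : 0 ≤ ∫ x : ℝ, (x ^ 2 - 1) ^ 2 ∂ν := integral_nonneg fun x => by positivity
  linarith [h.m4]

lemma Std4.iw2 (h : Std4 ν K) : Integrable (fun x : ℝ => (x ^ 2 - 1) ^ 2) ν := by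
  have := h.prob
  have e : (fun x : ℝ => (x ^ 2 - 1) ^ 2) = fun x => (x ^ 4 - 2 * x ^ 2) + 1 := by ext x; ring
  rw [e]
  exact (h.i4.sub (h.i2.const_mul 2)).add (integrable_const _)

lemma Std4.m3 (h : Std4 ν K) : ∫ x : ℝ, |x| ^ 3 ∂ν ≤ K := by
  have : ∫ x : ℝ, |x| ^ 3 ∂ν ≤ ∫ x : ℝ, (1/2) * (x ^ 2 + x ^ 4) ∂ν := by
    refine integral_mono h.i3 ((h.i2.add h.i4).const_mul (1/2)) fun x => ?_
    have : x ^ 2 = |x| ^ 2 := (sq_abs x).symm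
    have h4 : x ^ 4 = |x| ^ 4 := by rw [show x ^ 4 = (x ^ 2) ^ 2 by ring, this]; ring
    simp only [this, h4]
    nlinarith [sq_nonneg (|x| ^ 2 - |x|)]
  rw [integral_const_mul, integral_add h.i2 h.i4, h.m2] at this
  linarith [h.K1, h.m4]

lemma psi_add {y p q : ℝ} (hp : 0 ≤ p) (hq : 0 ≤ q) (hy : |y| ≤ p + q) :
    psi y ≤ 8 * p ^ 3 + 8 * q ^ 2 := by
  unfold psi
  have hy0 := abs_nonneg y
  rw [← sq_abs y]
  have hp3 : 0 ≤ p ^ 3 := by positivity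
  have hq2 : 0 ≤ q ^ 2 := by positivity
  rcases le_total q p with h | h
  · have h1 : |y| ≤ 2 * p := by linarith
    calc |y| ^ 2 * min 1 |y| ≤ |y| ^ 2 * |y| := by gcongr; exact min_le_right _ _
      _ = |y| ^ 3 := by ring
      _ ≤ (2 * p) ^ 3 := by gcongr
      _ ≤ _ := by nlinarith
  · have h1 : |y| ≤ 2 * q := by linarith
    calc |y| ^ 2 * min 1 |y| ≤ |y| ^ 2 * 1 := by gcongr; exact min_le_left _ _
      _ = |y| ^ 2 := by ring
      _ ≤ (2 * q) ^ 2 := by gcongr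
      _ ≤ _ := by nlinarith

/-- linearised statistic summand -/
def lin (M t x : ℝ) : ℝ := x / M - t * (x ^ 2 - 1) / (2 * M ^ 2)

lemma lin_int (h : Std4 ν K) (M t : ℝ) : ∫ x, lin M t x ∂ν = 0 := by
  have := h.prob
  have e : ∀ x, lin M t x = (1 / M) * x - (t / (2 * M ^ 2)) * (x ^ 2 - 1) := fun x => by
    unfold lin; ring
  simp_rw [e]
  have i : Integrable (fun x : ℝ => x ^ 2 - 1) ν := h.i2.sub (integrable_const _)
  rw [integral_sub (h.i1.const_mul _) (i.const_mul _), integral_const_mul, integral_const_mul,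
    integral_sub h.i2 (integrable_const _), h.m1, h.m2]
  simp

lemma lin_memLp (h : Std4 ν K) (M t : ℝ) : MemLp (lin M t) 2 ν := by
  have := h.prob
  have a1 : MemLp (fun x : ℝ => x) 2 ν := (memLp_two_iff_integrable_sq (by fun_prop)).2 h.i2
  have a2 : MemLp (fun x : ℝ => x ^ 2 - 1) 2 ν :=
    (memLp_two_iff_integrable_sq (by fun_prop)).2 h.iw2
  have e : lin M t = fun x => (1 / M) * x - (t / (2 * M ^ 2)) * (x ^ 2 - 1) := by
    ext x; unfold lin; ring
  rw [e]
  exact (a1.const_mul _).sub (a2.const_mul _)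

lemma lin_sq (h : Std4 ν K) {M : ℝ} (hM : 0 < M) (t : ℝ) :
    M ^ 2 * ∫ x, lin M t x ^ 2 ∂ν =
      1 - t / M * ∫ x, x ^ 3 ∂ν + t ^ 2 / (4 * M ^ 2) * (∫ x, x ^ 4 ∂ν - 1) := by
  have := h.prob
  have e : ∀ x, lin M t x ^ 2 = (1 / M ^ 2) * x ^ 2 - (t / M ^ 3) * (x ^ 3 - x)
      + (t ^ 2 / (4 * M ^ 4)) * (x ^ 2 - 1) ^ 2 := fun x => by
    unfold lin; field_simp; ring
  simp_rw [e]
  have i : Integrable (fun x : ℝ => x ^ 3 - x) ν := h.i3'.sub h.i1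
  have i' : Integrable (fun x : ℝ => (1 / M ^ 2) * x ^ 2 - (t / M ^ 3) * (x ^ 3 - x)) ν :=
    (h.i2.const_mul _).sub (i.const_mul _)
  rw [integral_add i' (h.iw2.const_mul _), integral_sub (h.i2.const_mul _) (i.const_mul _),
    integral_const_mul, integral_const_mul, integral_const_mul,
    integral_sub h.i3' h.i1, h.m1, h.m2, h.w2]
  field_simp
  ring

set_option maxHeartbeats 1000000 in
lemma lin_be (h : Std4 ν K) {m : ℕ} {M : ℝ} (hM : M = Real.sqrt m)
    (hM0 : 64 * (K + 1) ^ 2 ≤ M) {t s : ℝ} (ht : 0 ≤ t) (ht4 : t ^ 4 ≤ M)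
    (hs : |s - t| ≤ (1 + t) / M) :
    |(Pn ν m).real {ω | ∑ i, lin M t (ω i) ≤ s} - Φ t| ≤ 60000 * (K + 1) / M := by
  have := h.prob
  have hK := h.K1
  have hM1 : 64 ≤ M := by nlinarith
  have hMp : 0 < M := by linarith
  have hm : (m:ℝ) = M ^ 2 := by rw [hM, Real.sq_sqrt (by positivity)]
  have ht2 : t ^ 2 ≤ M := by
    rcases le_total t 1 with h1 | h1
    · nlinarith
    · nlinarith [sq_nonneg t, mul_self_nonneg (t^2 - 1), (by nlinarith : 1 ≤ t ^ 2)]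
  have ht1 : 8 * (K + 1) * t ≤ M := by
    refine (pow_le_pow_iff_left₀ (by positivity) hMp.le two_ne_zero).1 ?_
    calc (8 * (K + 1) * t) ^ 2 = (64 * (K + 1) ^ 2) * t ^ 2 := by ring
      _ ≤ M * M := by gcongr
      _ = M ^ 2 := by ring
  obtain ⟨n, rfl⟩ : ∃ n, m = n + 1 + 1 := by
    have : (2:ℝ) ≤ m := by rw [hm]; nlinarith
    have : 2 ≤ m := by exact_mod_cast this
    exact ⟨m - 2, by omega⟩
  set v := M ^ 2 * ∫ x, lin M t x ^ 2 ∂ν with hv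
  have hv1 : |v - 1| ≤ 2 * K * (t / M) := by
    rw [hv, lin_sq h hMp]
    have a1 : |∫ x, x ^ 3 ∂ν| ≤ K := by
      refine le_trans ?_ h.m3
      refine (abs_integral_le_integral_abs).trans (le_of_eq ?_)
      simp_rw [abs_pow]
    have a2 : 0 ≤ ∫ x, x ^ 4 ∂ν - 1 := by
      rw [← h.w2]; exact integral_nonneg fun x => by positivity
    have a3 : ∫ x, x ^ 4 ∂ν - 1 ≤ K := by linarith [h.m4]
    have b1 : |t / M * ∫ x, x ^ 3 ∂ν| ≤ t / M * K := by
      rw [abs_mul, abs_of_nonneg (by positivity : 0 ≤ t / M)]; gcongr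
    have b2 : t ^ 2 / (4 * M ^ 2) * (∫ x, x ^ 4 ∂ν - 1) ≤ t / M * K := by
      have : t ^ 2 / (4 * M ^ 2) ≤ t / M := by
        rw [div_le_div_iff₀ (by positivity) hMp]
        have : t ≤ M := by nlinarith
        nlinarith [mul_nonneg ht hMp.le, mul_le_mul_of_nonneg_left this (mul_nonneg ht hMp.le)]
      exact mul_le_mul this a3 a2 (by positivity)
    have b3 : 0 ≤ t ^ 2 / (4 * M ^ 2) * (∫ x, x ^ 4 ∂ν - 1) := mul_nonneg (by positivity) a2
    rw [abs_le] at b1 ⊢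
    constructor <;> linarith
  have htM : 0 ≤ t / M := by positivity
  have hv2 : |v - 1| ≤ 1 / 4 := by
    have : 8 * (K + 1) * (t / M) ≤ 1 := by
      rw [← mul_div_assoc, div_le_one hMp]; exact ht1
    nlinarith
  have hv3 : 1 / 2 ≤ v := by rw [abs_le] at hv2; linarith
  set r := Real.sqrt v with hr
  have hr2 : r ^ 2 = v := Real.sq_sqrt (by linarith)
  have hr0 : 1 / 2 ≤ r := by
    apply Real.le_sqrt_of_sq_le; linarith
  have hrp : 0 < r := by linarith
  have hr1 : |r - 1| ≤ |v - 1| := by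
    have : v - 1 = (r - 1) * (r + 1) := by rw [← hr2]; ring
    rw [this, abs_mul, abs_of_pos (by linarith : 0 < r + 1)]
    nlinarith [abs_nonneg (r - 1)]
  have hmeas : Measurable (lin M t) := by unfold lin; fun_prop
  have hcast : ((n + 1 + 1 : ℕ) : ℝ) = M ^ 2 := hm
  have be := berry_esseen (μ := ν) (n := n + 1) (by omega) (g := fun x => lin M t x / r)
    (hmeas.div_const _) (by simpa only [div_eq_mul_inv] using (lin_memLp h M t).mul_const r⁻¹)
    (by rw [integral_div, lin_int h, zero_div])
    (by simp_rw [div_pow]; rw [integral_div, hr2, hcast, ← mul_div_assoc, ← hv, div_self]; linarith)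
    (Γ := 72 * K / M) (by positivity)
    (by
      rw [hcast]
      have i : Integrable (fun x : ℝ => 64 / M ^ 3 * |x| ^ 3 + 8 * t ^ 2 / M ^ 4 * (x ^ 2 - 1) ^ 2) ν :=
        (h.i3.const_mul _).add (h.iw2.const_mul _)
      have : ∫ x, psi (lin M t x / r) ∂ν ≤
          ∫ x, (64 / M ^ 3 * |x| ^ 3 + 8 * t ^ 2 / M ^ 4 * (x ^ 2 - 1) ^ 2) ∂ν := by
        refine integral_mono_of_nonneg (Eventually.of_forall fun x => psi_nonneg _) i
          (Eventually.of_forall fun x => ?_)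
        have := psi_add (y := lin M t x / r) (p := 2 * |x| / M) (q := t * |x ^ 2 - 1| / M ^ 2)
          (by positivity) (by positivity) (by
            rw [abs_div, abs_of_pos hrp, div_le_iff₀ hrp]
            have e : |lin M t x| ≤ |x| / M + t * |x ^ 2 - 1| / (2 * M ^ 2) := by
              unfold lin
              refine (abs_sub _ _).trans (le_of_eq ?_)
              rw [abs_div, abs_div, abs_mul, abs_of_pos hMp, abs_of_nonneg ht,
                abs_of_pos (by positivity : 0 < 2 * M ^ 2)]
            refine e.trans ?_
            have : |x| / M + t * |x ^ 2 - 1| / (2 * M ^ 2) =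
              (2 * |x| / M + t * |x ^ 2 - 1| / M ^ 2) * (1 / 2) := by field_simp
            rw [this]
            gcongr)
        refine this.trans (le_of_eq ?_)
        simp only
        rw [← sq_abs (x ^ 2 - 1)]
        field_simp
        ring
      rw [integral_add (h.i3.const_mul _) (h.iw2.const_mul _), integral_const_mul,
        integral_const_mul, h.w2] at this
      have a3 : ∫ x, x ^ 4 ∂ν - 1 ≤ K := by linarith [h.m4]
      calc _ ≤ M ^ 2 * (64 / M ^ 3 * K + 8 * M / M ^ 4 * K) := by
            gcongr
            refine this.trans ?_
            have a4 := h.m3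
            gcongr
            rw [← h.w2]; exact integral_nonneg fun x => by positivity
        _ = (64 * K + 8 * K) / M := by field_simp
        _ = _ := by ring) (s / r)
  have hset : {ω : Fin (n + 1 + 1) → ℝ | ∑ i, lin M t (ω i) / r ≤ s / r} =
      {ω | ∑ i, lin M t (ω i) ≤ s} := by
    ext ω
    simp only [Set.mem_setOf_eq]
    rw [← Finset.sum_div, div_le_div_iff_of_pos_right hrp]
  rw [hset] at be
  have hst : |s / r - t| ≤ 2 * ((1 + t) / M + 2 * K * t ^ 2 / M) := by
    have e : s / r - t = (s - t - t * (r - 1)) / r := by field_simp; ring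
    rw [e, abs_div, abs_of_pos hrp, div_le_iff₀ hrp]
    have a1 : |s - t - t * (r - 1)| ≤ (1 + t) / M + 2 * K * t ^ 2 / M := by
      refine (abs_sub _ _).trans (add_le_add hs ?_)
      rw [abs_mul, abs_of_nonneg ht]
      calc t * |r - 1| ≤ t * (2 * K * (t / M)) := by gcongr; exact hr1.trans hv1
        _ = _ := by ring
    have : 0 ≤ (1 + t) / M + 2 * K * t ^ 2 / M := by positivity
    nlinarith
  have hPhi : |Φ (s / r) - Φ t| ≤ 32 * (K + 1) / M := by
    rcases le_total t 1 with h1 | h1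
    · refine (Phi_lip _ _).trans (hst.trans ?_)
      rw [← add_div, ← mul_div_assoc]
      have : t ^ 2 ≤ 1 := by nlinarith
      refine div_le_div_of_nonneg_right ?_ hMp.le
      nlinarith
    · have hst' : |s / r - t| ≤ 4 * (K + 1) * t ^ 2 / M := by
        refine hst.trans ?_
        rw [← add_div, ← mul_div_assoc]
        refine div_le_div_of_nonneg_right ?_ hMp.le
        nlinarith
      have hlow : t / 2 ≤ s / r := by
        have : 4 * (K + 1) * t ^ 2 / M ≤ t / 2 := by
          rw [div_le_iff₀ hMp]; nlinarith
        have := hst'.trans this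
        rw [abs_le] at this; linarith
      refine (Phi_dec h1 hlow).trans ?_
      calc 8 / t ^ 2 * |s / r - t| ≤ 8 / t ^ 2 * (4 * (K + 1) * t ^ 2 / M) := by gcongr
        _ = _ := by field_simp; ring
  have := abs_sub_le ((Pn ν (n+1+1)).real {ω | ∑ i, lin M t (ω i) ≤ s}) (Φ (s / r)) (Φ t)
  refine this.trans ((add_le_add be hPhi).trans ?_)
  rw [← mul_div_assoc, ← add_div]
  gcongr
  linarith

end

section
variable {ν : Measure ℝ} {K : ℝ}

/-- standardized sum -/
def sS (m : ℕ) (ω : Fin m → ℝ) : ℝ := (∑ i, ω i) / Real.sqrt m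
/-- normalized centred sum of squares -/
def sU (m : ℕ) (ω : Fin m → ℝ) : ℝ := (∑ i, (ω i ^ 2 - 1)) / m

lemma sV_eq {m : ℕ} (hm : 0 < m) (ω : Fin m → ℝ) :
    (∑ i, (ω i - (∑ j, ω j) / m) ^ 2) / m = 1 + sU m ω - sS m ω ^ 2 / m := by
  have hm' : (0:ℝ) < m := by exact_mod_cast hm
  unfold sU sS
  rw [div_pow, Real.sq_sqrt hm'.le]
  have : ∀ i, (ω i - (∑ j, ω j) / m) ^ 2
      = (ω i ^ 2 - 1) + (1 - (2 * ((∑ j, ω j) / m)) * ω i + ((∑ j, ω j) / m) ^ 2) := fun i => by ring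
  simp_rw [this]
  rw [Finset.sum_add_distrib, Finset.sum_add_distrib, Finset.sum_sub_distrib,
    Finset.sum_sub_distrib, ← Finset.mul_sum]
  simp only [Finset.sum_const, Finset.card_univ, Fintype.card_fin, nsmul_eq_mul]
  field_simp
  ring

lemma sV_nonneg {m : ℕ} (hm : 0 < m) (ω : Fin m → ℝ) :
    0 ≤ 1 + sU m ω - sS m ω ^ 2 / m := by
  rw [← sV_eq hm]; positivity

lemma stud_eq {m : ℕ} (hm : 0 < m) (ω : Fin m → ℝ) :
    studentized m ω = sS m ω / Real.sqrt (1 + sU m ω - sS m ω ^ 2 / m) := by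
  unfold studentized
  rw [sV_eq hm]
  congr 1
  have hm' : (0:ℝ) < m := by exact_mod_cast hm
  unfold sS
  have := Real.sq_sqrt hm'.le
  have h2 : 0 < Real.sqrt m := Real.sqrt_pos.2 hm'
  field_simp
  rw [this, mul_comm]

lemma lin_eq {m : ℕ} (t : ℝ) (ω : Fin m → ℝ) :
    ∑ i, lin (Real.sqrt m) t (ω i) = sS m ω - t * sU m ω / 2 := by
  unfold lin sS sU
  rw [Finset.sum_sub_distrib, ← Finset.sum_div, ← Finset.sum_div, ← Finset.mul_sum,
    Real.sq_sqrt (by positivity)]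
  ring

lemma sS_meas (m : ℕ) : Measurable (sS m) := by unfold sS; fun_prop
lemma sU_meas (m : ℕ) : Measurable (sU m) := by unfold sU; fun_prop
lemma stud_meas (m : ℕ) : Measurable (studentized m) := by unfold studentized; fun_prop

lemma stud_upper {m : ℕ} (hm : 0 < m) {z : ℝ} (hz : 0 ≤ z) (ω : Fin m → ℝ)
    (h : studentized m ω ≤ z) :
    sS m ω - z * sU m ω / 2 ≤ z ∨ 1 / 2 ≤ sS m ω ^ 2 / m ∨ 1 / 4 ≤ sU m ω ^ 2 := by
  have hV := sV_nonneg hm ω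
  rw [stud_eq hm] at h
  rcases hV.eq_or_lt with h0 | h0
  · right
    by_contra hcon
    push Not at hcon
    have h2 : -(1/2) ≤ sU m ω := by nlinarith [hcon.2]
    linarith [hcon.1]
  · left
    rw [div_le_iff₀ (Real.sqrt_pos.2 h0)] at h
    have hS : 0 ≤ sS m ω ^ 2 / m := by positivity
    have : Real.sqrt (1 + sU m ω - sS m ω ^ 2 / m) ≤ 1 + sU m ω / 2 := by
      apply Real.sqrt_le_iff.2
      constructor <;> nlinarith [sq_nonneg (sU m ω)]
    nlinarith

lemma stud_lower {m : ℕ} (hm : 0 < m) {z : ℝ} (hz : 0 ≤ z) (hzm : z ^ 2 ≤ m) (ω : Fin m → ℝ)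
    (h : z ≤ studentized m ω) (h0 : 0 < studentized m ω) (hu : sU m ω ≤ 1) :
    z * (1 - z ^ 2 / (2 * m)) * (1 + sU m ω / 2 - sU m ω ^ 2 / 2) ≤ sS m ω := by
  have hV := sV_nonneg hm ω
  have hm' : (0:ℝ) < m := by exact_mod_cast hm
  rw [stud_eq hm] at h h0
  set u := sU m ω
  set S := sS m ω
  rcases hV.eq_or_lt with hV0 | hV0
  · rw [← hV0] at h0; simp at h0
  have hsq := Real.sqrt_pos.2 hV0
  have hSp : 0 < S := by
    by_contra hcon
    have := div_nonpos_of_nonpos_of_nonneg (not_lt.1 hcon) hsq.le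
    linarith
  rw [le_div_iff₀ hsq] at h
  have hz2 : z ^ 2 * (1 + u - S ^ 2 / m) ≤ S ^ 2 := by
    have := pow_le_pow_left₀ (by positivity) h 2
    rwa [mul_pow, Real.sq_sqrt hV0.le] at this
  set a := z ^ 2 / m with ha
  have ha0 : 0 ≤ a := by positivity
  have ha1 : a ≤ 1 := by rw [ha, div_le_one hm']; exact hzm
  have e1 : z ^ 2 / (2 * m) = a / 2 := by rw [ha]; field_simp
  rw [e1]
  have hz3 : z ^ 2 * (1 + u) ≤ S ^ 2 * (1 + a) := by
    have : z ^ 2 * (S ^ 2 / m) = S ^ 2 * a := by rw [ha]; ring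
    linarith
  have hSm : 0 ≤ S ^ 2 / m := by positivity
  have hu1 : 0 < 1 + u := by linarith
  have e2 : 1 + u / 2 - u ^ 2 / 2 = (1 + u) * (2 - u) / 2 := by ring
  rw [e2]
  refine (pow_le_pow_iff_left₀ ?_ hSp.le two_ne_zero).1 ?_
  · have : 0 ≤ 1 - a / 2 := by linarith
    have : 0 ≤ 2 - u := by linarith
    positivity
  · have f1 : (1 - a / 2) ^ 2 * (1 + a) ≤ 1 := by
      have : (1 - a / 2) ^ 2 * (1 + a) = 1 - a ^ 2 * (3 - a) / 4 := by ring
      rw [this]; nlinarith [mul_nonneg (sq_nonneg a) (by linarith : 0 ≤ 3 - a)]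
    have f2 : (1 + u) * (2 - u) ^ 2 / 4 ≤ 1 := by
      have : (1 + u) * (2 - u) ^ 2 / 4 = 1 - u ^ 2 * (3 - u) / 4 := by ring
      rw [this]; nlinarith [mul_nonneg (sq_nonneg u) (by linarith : 0 ≤ 3 - u)]
    calc (z * (1 - a / 2) * ((1 + u) * (2 - u) / 2)) ^ 2
        = (1 - a / 2) ^ 2 * (z ^ 2 * (1 + u)) * ((1 + u) * (2 - u) ^ 2 / 4) := by ring
      _ ≤ (1 - a / 2) ^ 2 * (S ^ 2 * (1 + a)) * 1 := by gcongr
      _ = S ^ 2 * ((1 - a / 2) ^ 2 * (1 + a)) := by ring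
      _ ≤ S ^ 2 * 1 := by gcongr
      _ = S ^ 2 := by ring


lemma mS (h : Std4 ν K) {m : ℕ} (hm : 0 < m) :
    (Pn ν m).real {ω | 1 / 2 ≤ sS m ω ^ 2 / m} ≤ 2 / m := by
  have := h.prob
  have hm' : (0:ℝ) < m := by exact_mod_cast hm
  have hL : MemLp (fun x : ℝ => x) 2 ν := (memLp_two_iff_integrable_sq (by fun_prop)).2 h.i2
  have e : ∀ ω : Fin m → ℝ, sS m ω ^ 2 / m = (∑ i, ω i) ^ 2 / (m ^ 2) := fun ω => by
    unfold sS; rw [div_pow, Real.sq_sqrt hm'.le]; field_simp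
  simp_rw [e]
  have hi : Integrable (fun ω : Fin m → ℝ => (∑ i, ω i) ^ 2 / ((m:ℝ) ^ 2)) (Pn ν m) :=
    (memLp_sum hL).integrable_sq.div_const _
  have := mul_meas_ge_le_integral_of_nonneg (μ := Pn ν m)
    (Eventually.of_forall fun ω => by positivity) hi (1/2)
  rw [integral_div, sq_sum hL h.m1, h.m2] at this
  have e2 : (m:ℝ) * 1 / (m:ℝ) ^ 2 = 1 / m := by field_simp
  rw [e2] at this
  rw [show (2:ℝ) / m = 2 * (1 / m) by ring]
  linarith

lemma mU (h : Std4 ν K) {m : ℕ} (hm : 0 < m) {ε : ℝ} (hε : 0 < ε) :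
    (Pn ν m).real {ω | ε ≤ sU m ω ^ 2} ≤ K / (m * ε) := by
  have := h.prob
  have hm' : (0:ℝ) < m := by exact_mod_cast hm
  have hL : MemLp (fun x : ℝ => x ^ 2 - 1) 2 ν :=
    (memLp_two_iff_integrable_sq (by fun_prop)).2 h.iw2
  have h0 : ∫ x : ℝ, (x ^ 2 - 1) ∂ν = 0 := by
    rw [integral_sub h.i2 (integrable_const _), h.m2]; simp
  have e : ∀ ω : Fin m → ℝ, sU m ω ^ 2 = (∑ i, (ω i ^ 2 - 1)) ^ 2 / (m ^ 2) := fun ω => by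
    unfold sU; rw [div_pow]
  simp_rw [e]
  have hi : Integrable (fun ω : Fin m → ℝ => (∑ i, (ω i ^ 2 - 1)) ^ 2 / ((m:ℝ) ^ 2)) (Pn ν m) :=
    (memLp_sum hL).integrable_sq.div_const _
  have := mul_meas_ge_le_integral_of_nonneg (μ := Pn ν m)
    (Eventually.of_forall fun ω => by positivity) hi ε
  rw [integral_div, sq_sum hL h0, h.w2] at this
  rw [le_div_iff₀ (by positivity)]
  have e2 : (m:ℝ) * (∫ x, x ^ 4 ∂ν - 1) / (m:ℝ) ^ 2 = (∫ x, x ^ 4 ∂ν - 1) / m := by field_simp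
  rw [e2, le_div_iff₀ hm'] at this
  linarith [h.m4]

lemma sn_upper (h : Std4 ν K) {m : ℕ} (hM0 : 64 * (K + 1) ^ 2 ≤ Real.sqrt m) {z : ℝ}
    (hz : 0 ≤ z) :
    (Pn ν m).real {ω | studentized m ω ≤ z} ≤ Φ z + 60010 * (K + 1) / Real.sqrt m := by
  have := h.prob
  have hK := h.K1
  set M := Real.sqrt m with hM
  have hM1 : 64 ≤ M := by nlinarith
  have hMp : 0 < M := by linarith
  have hmM : (m:ℝ) = M ^ 2 := by rw [hM, Real.sq_sqrt (by positivity)]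
  have hm' : (0:ℝ) < m := by rw [hmM]; positivity
  have hm : 0 < m := by exact_mod_cast hm'
  rcases le_total M (z ^ 4) with h1 | h1
  · have hzp : 0 < z := by
      rcases hz.eq_or_lt with h0 | h0
      · rw [← h0] at h1; norm_num at h1; linarith
      · exact h0
    have h2 := Phi_tail hzp
    have h3 : 8 / z ^ 4 ≤ 8 / M := by gcongr
    have h4 : 8 / M ≤ 60010 * (K + 1) / M := by gcongr; linarith
    have h5 : (Pn ν m).real {ω | studentized m ω ≤ z} ≤ 1 := measureReal_le_one
    linarith
  · have hb := lin_be h hM hM0 hz h1 (s := z) (by rw [sub_self, abs_zero]; positivity)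
    have hsub : {ω : Fin m → ℝ | studentized m ω ≤ z} ⊆ {ω | ∑ i, lin M z (ω i) ≤ z} ∪
        ({ω | 1 / 2 ≤ sS m ω ^ 2 / m} ∪ {ω | 1 / 4 ≤ sU m ω ^ 2}) := by
      intro ω hω
      have := stud_upper hm hz ω hω
      simp only [Set.mem_union, Set.mem_setOf_eq]
      rw [hM, lin_eq]
      exact this
    have c1 := (measureReal_mono (μ := Pn ν m) hsub).trans ((measureReal_union_le _ _).trans
      (add_le_add le_rfl (measureReal_union_le _ _)))
    have c2 := mS h hm
    have c3 := mU h hm (ε := 1 / 4) (by norm_num)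
    have d2 : (2:ℝ) / m ≤ 2 / M := by rw [hmM]; gcongr; nlinarith
    have d3 : K / ((m:ℝ) * (1 / 4)) ≤ 4 * K / M := by
      rw [hmM, div_le_div_iff₀ (by positivity) hMp]
      nlinarith [mul_pos (mul_pos hMp (by linarith : 0 < K)) (by linarith : 0 < M - 1)]
    rw [abs_le] at hb
    have : 60000 * (K + 1) / M + (2 / M + 4 * K / M) ≤ 60010 * (K + 1) / M := by
      rw [← add_div, ← add_div]; gcongr; linarith
    linarith [hb.2]

lemma sn_lower1 (h : Std4 ν K) {m : ℕ} (hM0 : 64 * (K + 1) ^ 2 ≤ Real.sqrt m) {z : ℝ}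
    (hz : 0 ≤ z) (hz4 : z ^ 4 ≤ Real.sqrt m) :
    (Pn ν m).real {ω | z ≤ studentized m ω ∧ 0 < studentized m ω}
      ≤ 1 - Φ z + 60002 * (K + 1) / Real.sqrt m := by
  have := h.prob
  have hK := h.K1
  set M := Real.sqrt m with hM
  have hM1 : 64 ≤ M := by nlinarith
  have hMp : 0 < M := by linarith
  have hmM : (m:ℝ) = M ^ 2 := by rw [hM, Real.sq_sqrt (by positivity)]
  have hm' : (0:ℝ) < m := by rw [hmM]; positivity
  have hm : 0 < m := by exact_mod_cast hm'
  have hz2 : z ^ 2 ≤ M := by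
    rcases le_total z 1 with h1 | h1
    · nlinarith
    · nlinarith [sq_nonneg z, (by nlinarith : 1 ≤ z ^ 2)]
  have hz3 : z ^ 3 ≤ 2 * M := by
    nlinarith [sq_nonneg (z ^ 2 - z), sq_nonneg z]
  have ha : z ^ 2 / (2 * m) ≤ 1 := by
    rw [hmM, div_le_one (by positivity)]; nlinarith
  have ha0 : 0 ≤ z ^ 2 / (2 * m) := by positivity
  set t := z * (1 - z ^ 2 / (2 * m)) with ht
  have ht0 : 0 ≤ t := mul_nonneg hz (by linarith)
  have htz : t ≤ z := mul_le_of_le_one_right hz (by linarith)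
  have ht4 : t ^ 4 ≤ M := (pow_le_pow_left₀ ht0 htz 4).trans hz4
  set s0 := t - t / (2 * M) with hs0
  have hb := lin_be h hM hM0 ht0 ht4 (s := s0 - 1 / M) (by
    have : s0 - 1 / M - t = - ((1 + t / 2) / M) := by rw [hs0]; field_simp; ring
    rw [this, abs_neg, abs_of_nonneg (by positivity)]
    gcongr; linarith)
  have hmeas : MeasurableSet {ω : Fin m → ℝ | ∑ i, lin M t (ω i) ≤ s0 - 1 / M} := by
    apply measurableSet_le _ measurable_const
    unfold lin; fun_prop
  have hsub : {ω : Fin m → ℝ | z ≤ studentized m ω ∧ 0 < studentized m ω} ⊆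
      {ω | ∑ i, lin M t (ω i) ≤ s0 - 1 / M}ᶜ ∪ {ω | 1 / M ≤ sU m ω ^ 2} := by
    intro ω hω
    by_cases hu : 1 / M ≤ sU m ω ^ 2
    · exact Or.inr hu
    left
    simp only [Set.mem_compl_iff, Set.mem_setOf_eq, not_le]
    rw [not_le] at hu
    have hM2 : 1 / M ≤ 1 := by rw [div_le_one hMp]; linarith
    have hu1 : sU m ω ≤ 1 := by nlinarith
    have hl := stud_lower hm hz (by rw [hmM]; nlinarith) ω hω.1 hω.2 hu1
    rw [hM, lin_eq, ← hM]
    rw [← ht] at hl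
    have e : t * (sU m ω ^ 2 / 2) ≤ t / (2 * M) := by
      have : t / (2 * M) = t * (1 / M / 2) := by field_simp
      rw [this]; gcongr
    have : 0 < 1 / M := by positivity
    rw [hs0]
    linarith
  have c1 := (measureReal_mono (μ := Pn ν m) hsub).trans (measureReal_union_le _ _)
  rw [probReal_compl_eq_one_sub hmeas] at c1
  have c2 := mU h hm (ε := 1 / M) (by positivity)
  have c3 : K / ((m:ℝ) * (1 / M)) = K / M := by rw [hmM]; field_simp
  have c4 : Φ z - Φ t ≤ 1 / M := by
    refine (le_abs_self _).trans ((Phi_lip _ _).trans ?_)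
    have : z - t = z ^ 3 / (2 * M ^ 2) := by rw [ht, hmM]; ring
    rw [this, abs_of_nonneg (by positivity), div_le_div_iff₀ (by positivity) hMp]
    nlinarith
  rw [abs_le] at hb
  have : 60000 * (K + 1) / M + (K / M + 1 / M) ≤ 60002 * (K + 1) / M := by
    rw [← add_div, ← add_div]; gcongr; linarith
  linarith [hb.1]

lemma sn_lower (h : Std4 ν K) {m : ℕ} (hM0 : 64 * (K + 1) ^ 2 ≤ Real.sqrt m) {z : ℝ}
    (hz : 0 ≤ z) :
    (Pn ν m).real {ω | z ≤ studentized m ω ∧ 0 < studentized m ω}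
      ≤ 1 - Φ z + 60010 * (K + 1) / Real.sqrt m := by
  have := h.prob
  have hK := h.K1
  have hM1 : 64 ≤ Real.sqrt m := by nlinarith
  have hMp : 0 < Real.sqrt m := by linarith
  rcases le_total (z ^ 4) (Real.sqrt m) with h1 | h1
  · refine (sn_lower1 h hM0 hz h1).trans ?_
    gcongr; norm_num
  · set M := Real.sqrt m with hM
    set y := Real.sqrt (Real.sqrt M) with hy
    have hy4 : y ^ 4 = M := by
      rw [show y ^ 4 = (y ^ 2) ^ 2 by ring, hy, Real.sq_sqrt (by positivity),
        Real.sq_sqrt (by positivity)]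
    have hyp : 0 < y := by positivity
    have hyz : y ≤ z := by
      refine (pow_le_pow_iff_left₀ hyp.le hz (n := 4) (by norm_num)).1 (by rw [hy4]; exact h1)
    have hb := sn_lower1 h hM0 hyp.le hy4.le
    have ht := Phi_tail hyp
    rw [hy4] at ht
    have hsub : {ω : Fin m → ℝ | z ≤ studentized m ω ∧ 0 < studentized m ω} ⊆
        {ω : Fin m → ℝ | y ≤ studentized m ω ∧ 0 < studentized m ω} :=
      fun ω hω => ⟨hyz.trans hω.1, hω.2⟩
    have c1 := measureReal_mono (μ := Pn ν m) hsub
    have : 60002 * (K + 1) / M + 8 / M ≤ 60010 * (K + 1) / M := by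
      rw [← add_div]; gcongr; linarith
    linarith [Phi_le_one z]

lemma Std4.neg (h : Std4 ν K) : Std4 (ν.map (fun x => -x)) K := by
  have := h.prob
  have hm : Measurable (fun x : ℝ => -x) := measurable_neg
  refine ⟨Measure.isProbabilityMeasure_map hm.aemeasurable, ?_, ?_, ?_, ?_⟩
  · rw [integrable_map_measure (by fun_prop) hm.aemeasurable]
    refine h.i4.congr (Eventually.of_forall fun x => ?_)
    simp only [Function.comp]; ring
  · rw [integral_map hm.aemeasurable (by fun_prop), integral_neg, h.m1, neg_zero]
  · rw [integral_map hm.aemeasurable (by fun_prop)]; simpa using h.m2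
  · rw [integral_map hm.aemeasurable (by fun_prop)]
    simpa [Even.neg_pow (by decide : Even 4)] using h.m4

lemma stud_neg (m : ℕ) (ω : Fin m → ℝ) :
    studentized m (fun i => - ω i) = - studentized m ω := by
  unfold studentized
  simp only [Finset.sum_neg_distrib]
  have : ∀ i, (-ω i - (-∑ j, ω j) / m) ^ 2 = (ω i - (∑ j, ω j) / m) ^ 2 := fun i => by ring
  simp_rw [this]
  ring

lemma self_norm (h : Std4 ν K) {m : ℕ} (hm : 0 < m) (z : ℝ) :
    |(Pn ν m).real {ω | studentized m ω ≤ z} - Φ z| ≤ 60010 * (K + 1) ^ 2 / Real.sqrt m := by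
  have hp := h.prob
  have hK := h.K1
  have hm' : (0:ℝ) < m := by exact_mod_cast hm
  have hMp : 0 < Real.sqrt m := Real.sqrt_pos.2 hm'
  by_cases hM0 : 64 * (K + 1) ^ 2 ≤ Real.sqrt m
  swap
  · have h1 : 1 ≤ 60010 * (K + 1) ^ 2 / Real.sqrt m := by
      rw [le_div_iff₀ hMp]; nlinarith
    have h5 : (Pn ν m).real {ω | studentized m ω ≤ z} ≤ 1 := measureReal_le_one
    have h6 : 0 ≤ (Pn ν m).real {ω | studentized m ω ≤ z} := measureReal_nonneg
    rw [abs_le]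
    constructor <;> linarith [Phi_nonneg z, Phi_le_one z]
  have hle : 60010 * (K + 1) / Real.sqrt m ≤ 60010 * (K + 1) ^ 2 / Real.sqrt m := by
    gcongr; nlinarith
  refine le_trans ?_ hle
  have key : ∀ {ν' : Measure ℝ}, Std4 ν' K → ∀ {y : ℝ}, 0 ≤ y →
      1 - (Pn ν' m).real {ω | studentized m ω ≤ y}
        ≤ (Pn ν' m).real {ω | y ≤ studentized m ω ∧ 0 < studentized m ω} := by
    intro ν' h' y hy
    have := h'.prob
    rw [← probReal_compl_eq_one_sub (measurableSet_le (stud_meas m) measurable_const)]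
    refine measureReal_mono ?_
    intro ω hω
    simp only [Set.mem_compl_iff, Set.mem_setOf_eq, not_le] at hω ⊢
    exact ⟨hω.le, by linarith⟩
  rcases le_or_gt 0 z with hz | hz
  · have a := sn_upper h hM0 hz
    have b := sn_lower h hM0 hz
    have c := key h hz
    rw [abs_le]; constructor <;> linarith
  · have hz' : 0 ≤ -z := by linarith
    have h' := h.neg
    have := h'.prob
    have a := sn_upper h' hM0 hz'
    have b := sn_lower h' hM0 hz'
    have c := key h' hz'
    rw [Phi_neg] at a b
    have e : (Pn (ν.map fun x => -x) m).real {ω | -z ≤ studentized m ω ∧ 0 < studentized m ω}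
        = (Pn ν m).real {ω | studentized m ω ≤ z} := by
      have hh := Measure.pi_map_pi (μ := fun _ : Fin m => ν) (f := fun _ x => -x)
        (fun _ => measurable_neg.aemeasurable)
      unfold Pn
      have hS : MeasurableSet {ω : Fin m → ℝ | -z ≤ studentized m ω ∧ 0 < studentized m ω} :=
        (measurableSet_le measurable_const (stud_meas m)).inter
          (measurableSet_lt measurable_const (stud_meas m))
      rw [← hh, map_measureReal_apply (by fun_prop) hS]
      congr 1
      ext ω
      simp only [Set.mem_preimage, Set.mem_setOf_eq, Set.mem_inter_iff, stud_neg]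
      constructor
      · rintro ⟨h1, _⟩; linarith
      · intro h1; constructor <;> linarith
    rw [e] at b c
    rw [abs_le]; constructor <;> linarith


lemma stud_scale (m : ℕ) (ω : Fin m → ℝ) {r : ℝ} (hr : 0 < r) :
    studentized m (fun i => ω i / r) = studentized m ω := by
  unfold studentized
  have e1 : ∑ i, ω i / r = (∑ i, ω i) / r := by rw [Finset.sum_div]
  rw [e1]
  have : ∀ i, (ω i / r - (∑ j, ω j) / r / m) ^ 2 = (ω i - (∑ j, ω j) / m) ^ 2 / r ^ 2 :=
    fun i => by field_simp
  simp_rw [this]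
  rw [← Finset.sum_div, div_right_comm _ (r ^ 2), Real.sqrt_div (by positivity),
    Real.sqrt_sq hr.le]
  field_simp

lemma self_norm_gen {Ω : Type*} [MeasurableSpace Ω] {μ : Measure Ω} [IsProbabilityMeasure μ]
    {f : Ω → ℝ} (hf : Measurable f) (i4 : Integrable (fun x => f x ^ 4) μ)
    (h1 : ∫ x, f x ∂μ = 0) (h2 : 0 < ∫ x, f x ^ 2 ∂μ)
    (h4 : ∫ x, f x ^ 4 ∂μ ≤ K * (∫ x, f x ^ 2 ∂μ) ^ 2) {m : ℕ} (hm : 0 < m) (z : ℝ) :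
    |(Pn μ m).real {ω | studentized m (fun i => f (ω i)) ≤ z} - Φ z|
      ≤ 60010 * (K + 1) ^ 2 / Real.sqrt m := by
  set r := Real.sqrt (∫ x, f x ^ 2 ∂μ) with hr
  have hrp : 0 < r := Real.sqrt_pos.2 h2
  have hr2 : r ^ 2 = ∫ x, f x ^ 2 ∂μ := Real.sq_sqrt h2.le
  have hmf : Measurable fun x => f x / r := hf.div_const r
  have hS : Std4 (μ.map fun x => f x / r) K := by
    refine ⟨Measure.isProbabilityMeasure_map hmf.aemeasurable, ?_, ?_, ?_, ?_⟩
    · rw [integrable_map_measure (by fun_prop) hmf.aemeasurable]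
      refine (i4.div_const (r ^ 4)).congr (Eventually.of_forall fun x => ?_)
      simp only [Function.comp]; rw [div_pow]
    · rw [integral_map hmf.aemeasurable (by fun_prop), integral_div, h1, zero_div]
    · rw [integral_map hmf.aemeasurable (by fun_prop)]
      simp_rw [div_pow]
      rw [integral_div, hr2, div_self h2.ne']
    · rw [integral_map hmf.aemeasurable (by fun_prop)]
      simp_rw [div_pow]
      rw [integral_div, div_le_iff₀ (by positivity), show r ^ 4 = (r ^ 2) ^ 2 by ring, hr2]
      exact h4
  have := hS.prob
  have key := self_norm hS hm z
  have hh := Measure.pi_map_pi (μ := fun _ : Fin m => μ) (f := fun _ x => f x / r)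
        (fun _ => hmf.aemeasurable)
  unfold Pn at key
  rw [← hh, map_measureReal_apply (by fun_prop)
    (measurableSet_le (stud_meas m) measurable_const)] at key
  have e : (fun (x : Fin m → Ω) i => f (x i) / r) ⁻¹' {ω | studentized m ω ≤ z}
      = {ω | studentized m (fun i => f (ω i)) ≤ z} := by
    ext ω
    simp only [Set.mem_preimage, Set.mem_setOf_eq]
    rw [stud_scale m (fun i => f (ω i)) hrp]
  rw [e] at key
  exact key

end

section
variable {d : ℕ}

/-- polynomial functions in the coordinates of `s` of degree at most `n` -/
def PolyIn (s : Finset (Fin d)) (n : ℕ) : Submodule ℝ ((Fin d → ℝ) → ℝ) :=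
  Submodule.span ℝ {f | ∃ β : Fin d → ℕ, (∀ i, i ∉ s → β i = 0) ∧ ∑ i, β i ≤ n ∧
    f = fun x => ∏ i, x i ^ β i}

lemma PolyIn.mono {s t : Finset (Fin d)} {a b : ℕ} (hs : s ⊆ t) (hab : a ≤ b)
    {f : (Fin d → ℝ) → ℝ} (hf : f ∈ PolyIn s a) : f ∈ PolyIn t b := by
  refine Submodule.span_mono ?_ hf
  rintro f ⟨β, h1, h2, h3⟩
  exact ⟨β, fun i hi => h1 i (fun h => hi (hs h)), h2.trans hab, h3⟩

lemma PolyIn.const (s : Finset (Fin d)) (n : ℕ) (r : ℝ) : (fun _ => r) ∈ PolyIn s n := by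
  have : (fun _ : Fin d → ℝ => (1:ℝ)) ∈ PolyIn s n :=
    Submodule.subset_span ⟨fun _ => 0, by simp, by simp, by simp⟩
  have h2 := (PolyIn s n).smul_mem r this
  convert h2 using 1
  ext x; simp

lemma PolyIn.coord {s : Finset (Fin d)} {k : Fin d} (hk : k ∈ s) : (fun x => x k) ∈ PolyIn s 1 := by
  refine Submodule.subset_span ⟨Pi.single k 1, ?_, ?_, ?_⟩
  · intro i hi
    rw [Pi.single_eq_of_ne]; rintro rfl; exact hi hk
  · simp
  · ext x
    rw [Finset.prod_eq_single k]
    · simp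
    · intro b _ hb; simp [Pi.single_eq_of_ne hb]
    · simp

lemma PolyIn.add {s : Finset (Fin d)} {n : ℕ} {f g : (Fin d → ℝ) → ℝ} (hf : f ∈ PolyIn s n)
    (hg : g ∈ PolyIn s n) : (fun x => f x + g x) ∈ PolyIn s n := (PolyIn s n).add_mem hf hg

lemma PolyIn.sub {s : Finset (Fin d)} {n : ℕ} {f g : (Fin d → ℝ) → ℝ} (hf : f ∈ PolyIn s n)
    (hg : g ∈ PolyIn s n) : (fun x => f x - g x) ∈ PolyIn s n := (PolyIn s n).sub_mem hf hg

lemma PolyIn.smul {s : Finset (Fin d)} {n : ℕ} {f : (Fin d → ℝ) → ℝ} (r : ℝ)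
    (hf : f ∈ PolyIn s n) : (fun x => r * f x) ∈ PolyIn s n := (PolyIn s n).smul_mem r hf

lemma PolyIn.sum {s : Finset (Fin d)} {n : ℕ} {ι : Type*} (t : Finset ι)
    {f : ι → (Fin d → ℝ) → ℝ}
    (hf : ∀ i ∈ t, f i ∈ PolyIn s n) : (fun x => ∑ i ∈ t, f i x) ∈ PolyIn s n := by
  have := (PolyIn s n).sum_mem hf
  convert this using 1
  ext x; simp

lemma PolyIn.mul {s : Finset (Fin d)} {a b : ℕ} {f g : (Fin d → ℝ) → ℝ} (hf : f ∈ PolyIn s a)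
    (hg : g ∈ PolyIn s b) : (fun x => f x * g x) ∈ PolyIn s (a + b) := by
  change f * g ∈ _
  unfold PolyIn at hf
  induction hf using Submodule.span_induction with
  | zero => rw [zero_mul]; exact Submodule.zero_mem _
  | add x y _ _ hx hy => rw [add_mul]; exact Submodule.add_mem _ hx hy
  | smul r x _ hx => rw [smul_mul_assoc]; exact Submodule.smul_mem _ r hx
  | mem f hf =>
    obtain ⟨β, b1, b2, rfl⟩ := hf
    unfold PolyIn at hg
    induction hg using Submodule.span_induction with
    | zero => rw [mul_zero]; exact Submodule.zero_mem _
    | add x y _ _ hx hy => rw [mul_add]; exact Submodule.add_mem _ hx hy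
    | smul r x _ hx => rw [mul_smul_comm]; exact Submodule.smul_mem _ r hx
    | mem g hg =>
      obtain ⟨γ, c1, c2, rfl⟩ := hg
      refine Submodule.subset_span ⟨β + γ, fun i hi => ?_, ?_, ?_⟩
      · simp [b1 i hi, c1 i hi]
      · simp only [Pi.add_apply, Finset.sum_add_distrib]; omega
      · ext x
        simp only [Pi.mul_apply, Pi.add_apply, pow_add, Finset.prod_mul_distrib]

lemma PolyIn.pow {s : Finset (Fin d)} {a : ℕ} {f : (Fin d → ℝ) → ℝ} (hf : f ∈ PolyIn s a) (n : ℕ) :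
    (fun x => f x ^ n) ∈ PolyIn s (n * a) := by
  induction n with
  | zero => simpa using PolyIn.const s 0 1
  | succ n ih =>
    have := PolyIn.mul ih hf
    simp_rw [pow_succ, Nat.succ_mul]
    exact this

variable {P : Measure (Fin d → ℝ)} {Δ C₀ : ℝ}

lemma PolyIn.integrable (hP : CovModel P Δ C₀) {s : Finset (Fin d)} {n : ℕ} (hn : n ≤ 8)
    {f : (Fin d → ℝ) → ℝ} (hf : f ∈ PolyIn s n) : Integrable f P := by
  unfold PolyIn at hf
  induction hf using Submodule.span_induction with
  | zero => exact integrable_zero _ _ _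
  | add x y _ _ hx hy => exact hx.add hy
  | smul r x _ hx => exact hx.smul r
  | mem f hf =>
    obtain ⟨β, b1, b2, rfl⟩ := hf
    exact (hP.2.2.1 β (b2.trans hn)).1

lemma PolyIn.factor (hP : CovModel P Δ C₀) {s t : Finset (Fin d)} (hst : Disjoint s t)
    {a b : ℕ} (hab : a + b ≤ 8)
    {f g : (Fin d → ℝ) → ℝ} (hf : f ∈ PolyIn s a) (hg : g ∈ PolyIn t b) :
    ∫ x, f x * g x ∂P = (∫ x, f x ∂P) * ∫ x, g x ∂P := by
  have hpr : IsProbabilityMeasure P := hP.1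
  have hIntg : ∀ {f g : (Fin d → ℝ) → ℝ}, f ∈ PolyIn s a → g ∈ PolyIn t b →
      Integrable (fun x => f x * g x) P := fun {f g} hf hg =>
    PolyIn.integrable hP hab
      (PolyIn.mul (PolyIn.mono Finset.subset_union_left le_rfl hf)
        (PolyIn.mono Finset.subset_union_right le_rfl hg))
  have hf' := hf
  unfold PolyIn at hf'
  induction hf' using Submodule.span_induction with
  | zero => simp
  | add x y hx hy ihx ihy =>
    simp only [Pi.add_apply, add_mul]
    rw [integral_add (hIntg hx hg) (hIntg hy hg), ihx hx, ihy hy, integral_add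
      (PolyIn.integrable hP (by omega) hx) (PolyIn.integrable hP (by omega) hy)]
    ring
  | smul r x hx ih =>
    simp only [Pi.smul_apply, smul_eq_mul, mul_assoc]
    rw [integral_const_mul, integral_const_mul, ih hx, mul_assoc]
  | mem f hfm =>
    have hg' := hg
    unfold PolyIn at hg'
    induction hg' using Submodule.span_induction with
    | zero => simp
    | add x y hx hy ihx ihy =>
      simp only [Pi.add_apply, mul_add]
      rw [integral_add (hIntg hf hx) (hIntg hf hy), ihx hx, ihy hy, integral_add
        (PolyIn.integrable hP (by omega) hx) (PolyIn.integrable hP (by omega) hy)]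
      ring
    | smul r x hx ih =>
      simp only [Pi.smul_apply, smul_eq_mul, mul_left_comm _ r]
      rw [integral_const_mul, integral_const_mul, ih hx]
      ring
    | mem g hgm =>
      obtain ⟨β, b1, b2, rfl⟩ := hfm
      obtain ⟨γ, c1, c2, rfl⟩ := hgm
      have e : ∀ x : Fin d → ℝ, (∏ i, x i ^ β i) * ∏ i, x i ^ γ i = ∏ i, x i ^ (β + γ) i := by
        intro x
        simp only [Pi.add_apply, pow_add, Finset.prod_mul_distrib]
      simp_rw [e]
      have hs : ∑ i, (β + γ) i ≤ 8 := by
        simp only [Pi.add_apply, Finset.sum_add_distrib]; omega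
      rw [(hP.2.2.1 _ hs).2, (hP.2.2.1 β (by omega)).2, (hP.2.2.1 γ (by omega)).2,
        ← Finset.prod_mul_distrib]
      refine Finset.prod_congr rfl fun i _ => ?_
      by_cases hi : i ∈ s
      · have : i ∉ t := Finset.disjoint_left.1 hst hi
        simp [c1 i this]
      · simp [b1 i hi]

lemma cs_int {Ω : Type*} [MeasurableSpace Ω] {μ : Measure Ω} {f g : Ω → ℝ}
    (hf : Integrable (fun x => f x ^ 2) μ) (hg : Integrable (fun x => g x ^ 2) μ)
    (hfg : Integrable (fun x => f x * g x) μ) :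
    (∫ x, f x * g x ∂μ) ^ 2 ≤ (∫ x, f x ^ 2 ∂μ) * ∫ x, g x ^ 2 ∂μ := by
  have h : ∀ t : ℝ, 0 ≤ (∫ x, f x ^ 2 ∂μ) * (t * t) + (2 * ∫ x, f x * g x ∂μ) * t
      + ∫ x, g x ^ 2 ∂μ := by
    intro t
    have e : ∫ x, (t * f x + g x) ^ 2 ∂μ = (∫ x, f x ^ 2 ∂μ) * (t * t)
        + (2 * ∫ x, f x * g x ∂μ) * t + ∫ x, g x ^ 2 ∂μ := by
      have : ∀ x, (t * f x + g x) ^ 2 = (t * t) * f x ^ 2 + (2 * t) * (f x * g x) + g x ^ 2 :=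
        fun x => by ring
      simp_rw [this]
      have i : Integrable (fun x => (t * t) * f x ^ 2 + (2 * t) * (f x * g x)) μ :=
        (hf.const_mul _).add (hfg.const_mul _)
      rw [integral_add i hg, integral_add (hf.const_mul _) (hfg.const_mul _), integral_const_mul,
        integral_const_mul]
      ring
    rw [← e]
    exact integral_nonneg fun x => by positivity
  have := discrim_le_zero h
  unfold discrim at this
  nlinarith

end

section
variable {d : ℕ} {P : Measure (Fin d → ℝ)} {Δ C₀ : ℝ}

/-- linear form -/
def lf (b : Fin d → ℝ) (s : Finset (Fin d)) (x : Fin d → ℝ) : ℝ := ∑ i ∈ s, b i * x i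

/-- centred quadratic form -/
def qf (A : Fin d → Fin d → ℝ) (s : Finset (Fin d)) (x : Fin d → ℝ) : ℝ :=
  ∑ i ∈ s, ∑ j ∈ s, A i j * (x i * x j) - ∑ i ∈ s, A i i

lemma lf_mem (b : Fin d → ℝ) (s : Finset (Fin d)) : lf b s ∈ PolyIn s 1 :=
  PolyIn.sum s fun i hi => PolyIn.smul (b i) (PolyIn.coord hi)

lemma qf_mem (A : Fin d → Fin d → ℝ) (s : Finset (Fin d)) : qf A s ∈ PolyIn s 2 :=
  PolyIn.sub (f := fun x => ∑ i ∈ s, ∑ j ∈ s, A i j * (x i * x j))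
    (g := fun _ => ∑ i ∈ s, A i i)
    (PolyIn.sum (f := fun i x => ∑ j ∈ s, A i j * (x i * x j)) s fun i hi =>
      PolyIn.sum (f := fun j x => A i j * (x i * x j)) s fun j hj =>
        PolyIn.smul (f := fun x => x i * x j) (A i j)
          (PolyIn.mul (a := 1) (b := 1) (PolyIn.coord hi) (PolyIn.coord hj)))
    (PolyIn.const s 2 _)

lemma lf_insert (b : Fin d → ℝ) {s : Finset (Fin d)} {k : Fin d} (hk : k ∉ s) (x : Fin d → ℝ) :
    lf b (insert k s) x = lf b s x + b k * x k := by
  unfold lf; rw [Finset.sum_insert hk, add_comm]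

lemma qf_insert {A : Fin d → Fin d → ℝ} (hA : ∀ i j, A i j = A j i) {s : Finset (Fin d)}
    {k : Fin d} (hk : k ∉ s) (x : Fin d → ℝ) :
    qf A (insert k s) x = qf A s x + (lf (fun i => 2 * A k i) s x * x k + A k k * (x k ^ 2 - 1)) := by
  unfold qf lf
  simp only [Finset.sum_insert hk, Finset.sum_add_distrib]
  have e1 : ∑ j ∈ s, A k j * (x k * x j) = (∑ i ∈ s, A k i * x i) * x k := by
    rw [Finset.sum_mul]; exact Finset.sum_congr rfl fun i _ => by ring
  have e2 : ∑ j ∈ s, A j k * (x j * x k) = (∑ i ∈ s, A k i * x i) * x k := by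
    rw [Finset.sum_mul]; exact Finset.sum_congr rfl fun i _ => by rw [hA i k]; ring
  have e3 : ∑ i ∈ s, 2 * A k i * x i = 2 * ∑ i ∈ s, A k i * x i := by
    rw [Finset.mul_sum]; exact Finset.sum_congr rfl fun i _ => by ring
  rw [e1, e2, e3]
  ring

lemma xk_mem (k : Fin d) (r : ℕ) : (fun x : Fin d → ℝ => x k ^ r) ∈ PolyIn {k} r := by
  have := PolyIn.pow (PolyIn.coord (Finset.mem_singleton_self k)) r
  rwa [mul_one] at this

lemma xk1_mem (k : Fin d) : (fun x : Fin d → ℝ => x k ^ 2 - 1) ∈ PolyIn {k} 2 :=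
  PolyIn.sub (xk_mem k 2) (PolyIn.const _ _ 1)

lemma mu4_le (hP : CovModel P Δ C₀) (k : Fin d) : ∫ x, x k ^ 4 ∂P ≤ 1 + C₀ := by
  have hpr : IsProbabilityMeasure P := hP.1
  have i4 := PolyIn.integrable hP (by norm_num) (xk_mem k 4)
  have i8 := PolyIn.integrable hP (by norm_num) (xk_mem k 8)
  have : ∫ x, x k ^ 4 ∂P ≤ ∫ x, (1 + x k ^ 8) ∂P := by
    refine integral_mono i4 ((integrable_const _).add i8) fun x => ?_
    simp only
    nlinarith [sq_nonneg (x k ^ 4 - 1), sq_nonneg (x k ^ 4)]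
  rw [integral_add (integrable_const _) i8] at this
  have h8 := hP.2.2.2.2.2.2.2 k
  simp at this
  linarith

lemma xk1_int (hP : CovModel P Δ C₀) (k : Fin d) : ∫ x, (x k ^ 2 - 1) ∂P = 0 := by
  have hpr : IsProbabilityMeasure P := hP.1
  rw [integral_sub (PolyIn.integrable hP (by norm_num) (xk_mem k 2)) (integrable_const _),
    hP.2.2.2.2.2.1 k]
  simp

lemma xk1_sq (hP : CovModel P Δ C₀) (k : Fin d) : ∫ x, (x k ^ 2 - 1) ^ 2 ∂P = Δ + 2 := by
  have hpr : IsProbabilityMeasure P := hP.1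
  have e : ∀ x : Fin d → ℝ, (x k ^ 2 - 1) ^ 2 = x k ^ 4 - 2 * x k ^ 2 + 1 := fun x => by ring
  simp_rw [e]
  have i4 := PolyIn.integrable hP (by norm_num) (xk_mem k 4)
  have i2 := PolyIn.integrable hP (by norm_num) (xk_mem k 2)
  have i : Integrable (fun x : Fin d → ℝ => x k ^ 4 - 2 * x k ^ 2) P := i4.sub (i2.const_mul 2)
  rw [integral_add i (integrable_const _), integral_sub i4 (i2.const_mul 2), integral_const_mul,
    hP.2.2.2.2.2.1 k, hP.2.2.2.2.2.2.1 k]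
  simp; ring

lemma xk1_four (hP : CovModel P Δ C₀) (k : Fin d) :
    ∫ x, (x k ^ 2 - 1) ^ 4 ∂P ≤ 8 * (C₀ + 1) := by
  have hpr : IsProbabilityMeasure P := hP.1
  have i8 := PolyIn.integrable hP (by norm_num) (xk_mem k 8)
  have i := PolyIn.integrable hP (by norm_num) (PolyIn.pow (xk1_mem k) 4)
  have : ∫ x, (x k ^ 2 - 1) ^ 4 ∂P ≤ ∫ x, 8 * (x k ^ 8 + 1) ∂P := by
    refine integral_mono i ((i8.add (integrable_const _)).const_mul 8) fun x => ?_
    simp only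
    have h1 : (x k ^ 2 - 1) ^ 2 ≤ x k ^ 4 + 1 := by nlinarith [sq_nonneg (x k)]
    calc (x k ^ 2 - 1) ^ 4 = ((x k ^ 2 - 1) ^ 2) ^ 2 := by ring
      _ ≤ (x k ^ 4 + 1) ^ 2 := by gcongr
      _ ≤ 8 * (x k ^ 8 + 1) := by nlinarith [sq_nonneg (x k ^ 4 - 1), sq_nonneg (x k ^ 4)]
  rw [integral_const_mul, integral_add i8 (integrable_const _)] at this
  have h8 := hP.2.2.2.2.2.2.2 k
  simp at this
  linarith

lemma fac (hP : CovModel P Δ C₀) {s : Finset (Fin d)} {k : Fin d} (hk : k ∉ s)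
    {a b : ℕ} (hab : a + b ≤ 8) {f g : (Fin d → ℝ) → ℝ} (hf : f ∈ PolyIn s a)
    (hg : g ∈ PolyIn {k} b) :
    Integrable (fun x => f x * g x) P ∧ ∫ x, f x * g x ∂P = (∫ x, f x ∂P) * ∫ x, g x ∂P := by
  refine ⟨PolyIn.integrable hP hab (s := s ∪ {k})
      (PolyIn.mul (PolyIn.mono Finset.subset_union_left le_rfl hf)
        (PolyIn.mono Finset.subset_union_right le_rfl hg)),
    PolyIn.factor hP (by simpa using hk) hab hf hg⟩

lemma fac1 (hP : CovModel P Δ C₀) {s : Finset (Fin d)} {k : Fin d} (hk : k ∉ s)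
    {a : ℕ} (hab : a + 1 ≤ 8) {f : (Fin d → ℝ) → ℝ} (hf : f ∈ PolyIn s a) :
    Integrable (fun x => f x * x k) P ∧ ∫ x, f x * x k ∂P = 0 := by
  have := fac hP hk hab hf (PolyIn.coord (Finset.mem_singleton_self k))
  rw [hP.2.2.2.1 k, mul_zero] at this
  exact this

lemma fac2 (hP : CovModel P Δ C₀) {s : Finset (Fin d)} {k : Fin d} (hk : k ∉ s)
    {a : ℕ} (hab : a + 2 ≤ 8) {f : (Fin d → ℝ) → ℝ} (hf : f ∈ PolyIn s a) :
    Integrable (fun x => f x * x k ^ 2) P ∧ ∫ x, f x * x k ^ 2 ∂P = ∫ x, f x ∂P := by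
  have := fac hP hk hab hf (xk_mem k 2)
  rw [hP.2.2.2.2.2.1 k, mul_one] at this
  exact this

lemma fac21 (hP : CovModel P Δ C₀) {s : Finset (Fin d)} {k : Fin d} (hk : k ∉ s)
    {a : ℕ} (hab : a + 2 ≤ 8) {f : (Fin d → ℝ) → ℝ} (hf : f ∈ PolyIn s a) :
    Integrable (fun x => f x * (x k ^ 2 - 1)) P ∧ ∫ x, f x * (x k ^ 2 - 1) ∂P = 0 := by
  have := fac hP hk hab hf (xk1_mem k)
  rw [xk1_int hP, mul_zero] at this
  exact this

lemma fac22 (hP : CovModel P Δ C₀) {s : Finset (Fin d)} {k : Fin d} (hk : k ∉ s)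
    {a : ℕ} (hab : a + 4 ≤ 8) {f : (Fin d → ℝ) → ℝ} (hf : f ∈ PolyIn s a) :
    Integrable (fun x => f x * (x k ^ 2 - 1) ^ 2) P ∧
      ∫ x, f x * (x k ^ 2 - 1) ^ 2 ∂P = (∫ x, f x ∂P) * (Δ + 2) := by
  have := fac hP hk hab hf (PolyIn.pow (xk1_mem k) 2)
  rw [xk1_sq hP] at this
  exact this

lemma lf_int (hP : CovModel P Δ C₀) (b : Fin d → ℝ) (s : Finset (Fin d)) :
    ∫ x, lf b s x ∂P = 0 := by
  unfold lf
  rw [integral_finsetSum]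
  · refine Finset.sum_eq_zero fun i _ => ?_
    rw [integral_const_mul, hP.2.2.2.1 i, mul_zero]
  · intro i hi
    exact PolyIn.integrable hP (by norm_num) (PolyIn.smul (b i) (PolyIn.coord hi))

lemma lf_sq (hP : CovModel P Δ C₀) (b : Fin d → ℝ) (s : Finset (Fin d)) :
    ∫ x, lf b s x ^ 2 ∂P = ∑ i ∈ s, b i ^ 2 := by
  have hpr : IsProbabilityMeasure P := hP.1
  induction s using Finset.induction_on with
  | empty => simp [lf]
  | insert k s hk ih =>
    rw [Finset.sum_insert hk, ← ih]
    have e : ∀ x, lf b (insert k s) x ^ 2 = lf b s x ^ 2 + (2 * b k) * (lf b s x * x k)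
        + b k ^ 2 * x k ^ 2 := fun x => by rw [lf_insert b hk]; ring
    simp_rw [e]
    have i1 := PolyIn.integrable hP (by norm_num) (PolyIn.pow (lf_mem b s) 2)
    obtain ⟨i2, j2⟩ := fac1 hP hk (by norm_num) (lf_mem b s)
    have i3 := PolyIn.integrable hP (by norm_num) (xk_mem k 2)
    have i12 : Integrable (fun x => lf b s x ^ 2 + (2 * b k) * (lf b s x * x k)) P :=
      i1.add (i2.const_mul _)
    rw [integral_add i12 (i3.const_mul _), integral_add i1 (i2.const_mul _), integral_const_mul,
      integral_const_mul, j2, hP.2.2.2.2.2.1 k]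
    ring

lemma lf_four (hP : CovModel P Δ C₀) (hC : 0 < C₀) (b : Fin d → ℝ) (s : Finset (Fin d)) :
    ∫ x, lf b s x ^ 4 ∂P ≤ (4 + C₀) * (∫ x, lf b s x ^ 2 ∂P) ^ 2 := by
  have hpr : IsProbabilityMeasure P := hP.1
  induction s using Finset.induction_on with
  | empty => simp [lf]
  | insert k s hk ih =>
    have e2 : ∫ x, lf b (insert k s) x ^ 2 ∂P = ∫ x, lf b s x ^ 2 ∂P + b k ^ 2 := by
      rw [lf_sq hP, lf_sq hP, Finset.sum_insert hk, add_comm]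
    have e : ∀ x, lf b (insert k s) x ^ 4 = lf b s x ^ 4 + (4 * b k) * (lf b s x ^ 3 * x k)
        + (6 * b k ^ 2) * (lf b s x ^ 2 * x k ^ 2) + (4 * b k ^ 3) * (lf b s x * x k ^ 3)
        + b k ^ 4 * x k ^ 4 := fun x => by rw [lf_insert b hk]; ring
    simp_rw [e]
    have hl := lf_mem b s
    have i1 := PolyIn.integrable hP (by norm_num) (PolyIn.pow hl 4)
    obtain ⟨i2, j2⟩ := fac1 hP hk (by norm_num) (PolyIn.pow hl 3)
    obtain ⟨i3, j3⟩ := fac2 hP hk (by norm_num) (PolyIn.pow hl 2)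
    obtain ⟨i4, j4⟩ := fac hP hk (by norm_num) hl (xk_mem k 3)
    rw [lf_int hP, zero_mul] at j4
    have i5 := PolyIn.integrable hP (by norm_num) (xk_mem k 4)
    have k1 : Integrable (fun x => lf b s x ^ 4 + (4 * b k) * (lf b s x ^ 3 * x k)) P :=
      i1.add (i2.const_mul _)
    have k2 : Integrable (fun x => lf b s x ^ 4 + (4 * b k) * (lf b s x ^ 3 * x k)
        + (6 * b k ^ 2) * (lf b s x ^ 2 * x k ^ 2)) P := k1.add (i3.const_mul _)
    have k3 : Integrable (fun x => lf b s x ^ 4 + (4 * b k) * (lf b s x ^ 3 * x k)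
        + (6 * b k ^ 2) * (lf b s x ^ 2 * x k ^ 2) + (4 * b k ^ 3) * (lf b s x * x k ^ 3)) P :=
      k2.add (i4.const_mul _)
    rw [integral_add k3 (i5.const_mul _), integral_add k2 (i4.const_mul _),
      integral_add k1 (i3.const_mul _), integral_add i1 (i2.const_mul _),
      integral_const_mul, integral_const_mul, integral_const_mul, integral_const_mul,
      j2, j3, j4, e2]
    have m4 := mu4_le hP k
    set p := ∫ x, lf b s x ^ 2 ∂P
    have hp : 0 ≤ p := integral_nonneg fun x => by positivity
    have h1 : b k ^ 4 * ∫ x, x k ^ 4 ∂P ≤ b k ^ 4 * (1 + C₀) :=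
      mul_le_mul_of_nonneg_left m4 (by positivity)
    have h2 : 0 ≤ p * b k ^ 2 := by positivity
    have h3 : 0 ≤ C₀ * (p * b k ^ 2) := by positivity
    have h4 : 0 ≤ b k ^ 4 := by positivity
    have e4 : (4 + C₀) * (p + b k ^ 2) ^ 2 =
      (4 + C₀) * p ^ 2 + 8 * (p * b k ^ 2) + 2 * (C₀ * (p * b k ^ 2)) + (4 + C₀) * b k ^ 4 := by ring
    rw [e4]
    linarith

lemma qf_sq_insert (hP : CovModel P Δ C₀) {A : Fin d → Fin d → ℝ} (hA : ∀ i j, A i j = A j i)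
    {s : Finset (Fin d)} {k : Fin d} (hk : k ∉ s) :
    ∫ x, qf A (insert k s) x ^ 2 ∂P = ∫ x, qf A s x ^ 2 ∂P
      + ∫ x, lf (fun i => 2 * A k i) s x ^ 2 ∂P + A k k ^ 2 * (Δ + 2) := by
  have hpr : IsProbabilityMeasure P := hP.1
  set l := lf (fun i => 2 * A k i) s with hl
  set q := qf A s with hq
  set a := A k k
  have ml : l ∈ PolyIn s 1 := lf_mem _ _
  have mq : q ∈ PolyIn s 2 := qf_mem _ _
  have hlz : ∫ x, l x ∂P = 0 := lf_int hP _ _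
  have e : ∀ x, qf A (insert k s) x ^ 2 = q x ^ 2 + l x ^ 2 * x k ^ 2
      + a ^ 2 * (x k ^ 2 - 1) ^ 2 + 2 * ((q x * l x) * x k)
      + (2 * a) * (q x * (x k ^ 2 - 1)) + (2 * a) * (l x * (x k * (x k ^ 2 - 1))) := fun x => by
    rw [qf_insert hA hk]; ring
  simp_rw [e]
  have i1 := PolyIn.integrable hP (by norm_num) (PolyIn.pow mq 2)
  obtain ⟨i2, j2⟩ := fac2 hP hk (by norm_num) (PolyIn.pow ml 2)
  have i3 := PolyIn.integrable hP (by norm_num) (PolyIn.pow (xk1_mem k) 2)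
  obtain ⟨i4, j4⟩ := fac1 hP hk (by norm_num) (PolyIn.mul mq ml)
  obtain ⟨i5, j5⟩ := fac21 hP hk (by norm_num) mq
  obtain ⟨i6, j6⟩ := fac hP hk (by norm_num) ml
    (PolyIn.mul (PolyIn.coord (Finset.mem_singleton_self k)) (xk1_mem k))
  rw [hlz, zero_mul] at j6
  have k2 : Integrable (fun x => q x ^ 2 + l x ^ 2 * x k ^ 2) P := i1.add i2
  have k3 : Integrable (fun x => q x ^ 2 + l x ^ 2 * x k ^ 2 + a ^ 2 * (x k ^ 2 - 1) ^ 2) P :=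
    k2.add (i3.const_mul _)
  have k4 : Integrable (fun x => q x ^ 2 + l x ^ 2 * x k ^ 2 + a ^ 2 * (x k ^ 2 - 1) ^ 2
    + 2 * ((q x * l x) * x k)) P := k3.add (i4.const_mul _)
  have k5 : Integrable (fun x => q x ^ 2 + l x ^ 2 * x k ^ 2 + a ^ 2 * (x k ^ 2 - 1) ^ 2
    + 2 * ((q x * l x) * x k) + (2 * a) * (q x * (x k ^ 2 - 1))) P := k4.add (i5.const_mul _)
  rw [integral_add k5 (i6.const_mul _), integral_add k4 (i5.const_mul _),
    integral_add k3 (i4.const_mul _), integral_add k2 (i3.const_mul _), integral_add i1 i2,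
    integral_const_mul, integral_const_mul, integral_const_mul, integral_const_mul,
    j2, j4, j5, j6, xk1_sq hP]
  ring

lemma qf_int (hP : CovModel P Δ C₀) {A : Fin d → Fin d → ℝ} (hA : ∀ i j, A i j = A j i)
    (s : Finset (Fin d)) : ∫ x, qf A s x ∂P = 0 := by
  have hpr : IsProbabilityMeasure P := hP.1
  induction s using Finset.induction_on with
  | empty => simp [qf]
  | insert k s hk ih =>
    simp_rw [qf_insert hA hk]
    have i1 := PolyIn.integrable hP (by norm_num) (qf_mem A s)
    obtain ⟨i2, j2⟩ := fac1 hP hk (by norm_num) (lf_mem (fun i => 2 * A k i) s)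
    have i3 := PolyIn.integrable hP (by norm_num) (xk1_mem k)
    have i23 : Integrable (fun x => lf (fun i => 2 * A k i) s x * x k
      + A k k * (x k ^ 2 - 1)) P := i2.add (i3.const_mul _)
    rw [integral_add i1 i23, integral_add i2 (i3.const_mul _), integral_const_mul, ih, j2,
      xk1_int hP]
    simp

lemma qf_zero (hP : CovModel P Δ C₀) (hΔ : 0 < Δ + 2) {A : Fin d → Fin d → ℝ}
    (hA : ∀ i j, A i j = A j i)
    (s : Finset (Fin d)) (h0 : ∫ x, qf A s x ^ 2 ∂P = 0) : ∀ i ∈ s, ∀ j ∈ s, A i j = 0 := by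
  induction s using Finset.induction_on with
  | empty => simp
  | insert k s hk ih =>
    rw [qf_sq_insert hP hA hk, lf_sq hP] at h0
    have p1 : 0 ≤ ∫ x, qf A s x ^ 2 ∂P := integral_nonneg fun x => by positivity
    have p2 : 0 ≤ ∑ i ∈ s, (2 * A k i) ^ 2 := by positivity
    have p3 : 0 ≤ A k k ^ 2 * (Δ + 2) := by positivity
    have q1 := ih (by linarith)
    have q2 : ∑ i ∈ s, (2 * A k i) ^ 2 = 0 := by linarith
    have q3 : A k k ^ 2 * (Δ + 2) = 0 := by linarith
    rw [Finset.sum_eq_zero_iff_of_nonneg (fun i _ => by positivity)] at q2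
    have r2 : ∀ i ∈ s, A k i = 0 := fun i hi => by
      have := q2 i hi
      simpa using this
    have r3 : A k k = 0 := by
      rcases mul_eq_zero.1 q3 with h | h
      · simpa using h
      · linarith
    intro i hi j hj
    rcases Finset.mem_insert.1 hi with hik | hi
    · rw [hik]
      rcases Finset.mem_insert.1 hj with hjk | hj
      · rw [hjk]; exact r3
      · exact r2 j hj
    · rcases Finset.mem_insert.1 hj with hjk | hj
      · rw [hjk, hA]; exact r2 i hi
      · exact q1 i hi j hj

/-- fourth moment constant -/
def K8 (c C₀ : ℝ) : ℝ := 64 * (4 + C₀) + 24 * (4 + C₀) * (1 + C₀) + 192 * (C₀ + 1) / c ^ 2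

lemma quart_ineq (y u v : ℝ) : (y + (u + v)) ^ 4 ≤ y ^ 4 + 4 * y ^ 3 * u + 4 * y ^ 3 * v
    + 16 * (y ^ 2 * u ^ 2) + 16 * (y ^ 2 * v ^ 2) + 24 * u ^ 4 + 24 * v ^ 4 := by
  have h1 : ∀ g : ℝ, (y + g) ^ 4 ≤ y ^ 4 + 4 * y ^ 3 * g + 8 * (y ^ 2 * g ^ 2)
      + 3 * (g ^ 2) ^ 2 := fun g => by
    have := mul_nonneg (sq_nonneg g) (sq_nonneg (y - g))
    have e : y ^ 4 + 4 * y ^ 3 * g + 8 * (y ^ 2 * g ^ 2) + 3 * (g ^ 2) ^ 2 - (y + g) ^ 4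
      = 2 * (g ^ 2 * (y - g) ^ 2) := by ring
    linarith
  have h2 : (u + v) ^ 2 ≤ 2 * u ^ 2 + 2 * v ^ 2 := by nlinarith [sq_nonneg (u - v)]
  have h3 : ((u + v) ^ 2) ^ 2 ≤ 8 * u ^ 4 + 8 * v ^ 4 := by
    have := pow_le_pow_left₀ (sq_nonneg _) h2 2
    have e : (2 * u ^ 2 + 2 * v ^ 2) ^ 2 = 8 * u ^ 4 + 8 * v ^ 4 - 4 * (u ^ 2 - v ^ 2) ^ 2 := by
      ring
    have := sq_nonneg (u ^ 2 - v ^ 2)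
    linarith
  have h4 : y ^ 2 * (u + v) ^ 2 ≤ y ^ 2 * (2 * u ^ 2 + 2 * v ^ 2) := by gcongr
  have := h1 (u + v)
  linarith

set_option maxHeartbeats 2000000 in
lemma qf_four (hP : CovModel P Δ C₀) (hC : 0 < C₀) {c : ℝ} (hc : 0 < c) (hΔ : c < Δ + 2)
    {A : Fin d → Fin d → ℝ} (hA : ∀ i j, A i j = A j i) (s : Finset (Fin d)) :
    ∫ x, qf A s x ^ 4 ∂P ≤ K8 c C₀ * (∫ x, qf A s x ^ 2 ∂P) ^ 2 := by
  have hpr : IsProbabilityMeasure P := hP.1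
  have hKa : 64 * (4 + C₀) ≤ K8 c C₀ := by
    unfold K8
    have : 0 ≤ 24 * (4 + C₀) * (1 + C₀) := by positivity
    have : 0 ≤ 192 * (C₀ + 1) / c ^ 2 := by positivity
    linarith
  have hKb : 24 * (4 + C₀) * (1 + C₀) ≤ K8 c C₀ := by
    unfold K8
    have : 0 ≤ 192 * (C₀ + 1) / c ^ 2 := by positivity
    linarith
  have hKc : 192 * (C₀ + 1) ≤ K8 c C₀ * (Δ + 2) ^ 2 := by
    have h1 : 192 * (C₀ + 1) / c ^ 2 ≤ K8 c C₀ := by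
      unfold K8
      have : 0 ≤ 24 * (4 + C₀) * (1 + C₀) := by positivity
      linarith
    calc 192 * (C₀ + 1) = 192 * (C₀ + 1) / c ^ 2 * c ^ 2 := by field_simp
      _ ≤ K8 c C₀ * (Δ + 2) ^ 2 := by gcongr; linarith
  set K := K8 c C₀
  have hK0 : 0 < K := by linarith
  induction s using Finset.induction_on with
  | empty => simp [qf]
  | insert k s hk ih =>
    rw [qf_sq_insert hP hA hk]
    set l := lf (fun i => 2 * A k i) s with hl
    set q := qf A s with hq
    set a := A k k
    have ml : l ∈ PolyIn s 1 := lf_mem _ _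
    have mq : q ∈ PolyIn s 2 := qf_mem _ _
    have l4 : ∫ x, l x ^ 4 ∂P ≤ (4 + C₀) * (∫ x, l x ^ 2 ∂P) ^ 2 := lf_four hP hC _ _
    have i1 := PolyIn.integrable hP (by norm_num) (PolyIn.pow mq 4)
    obtain ⟨i2, j2⟩ := fac1 hP hk (by norm_num) (PolyIn.mul (PolyIn.pow mq 3) ml)
    obtain ⟨i3, j3⟩ := fac21 hP hk (by norm_num) (PolyIn.pow mq 3)
    obtain ⟨i4, j4⟩ := fac2 hP hk (by norm_num) (PolyIn.mul (PolyIn.pow mq 2) (PolyIn.pow ml 2))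
    obtain ⟨i5, j5⟩ := fac22 hP hk (by norm_num) (PolyIn.pow mq 2)
    obtain ⟨i6, j6⟩ := fac hP hk (by norm_num) (PolyIn.pow ml 4) (xk_mem k 4)
    have i7 := PolyIn.integrable hP (by norm_num) (PolyIn.pow (xk1_mem k) 4)
    have j7 := xk1_four hP k
    have m4 := mu4_le hP k
    have k2 : Integrable (fun x => q x ^ 4 + 4 * (q x ^ 3 * l x * x k)) P :=
      i1.add (i2.const_mul _)
    have k3 : Integrable (fun x => q x ^ 4 + 4 * (q x ^ 3 * l x * x k)
      + (4 * a) * (q x ^ 3 * (x k ^ 2 - 1))) P := k2.add (i3.const_mul _)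
    have k4 : Integrable (fun x => q x ^ 4 + 4 * (q x ^ 3 * l x * x k)
      + (4 * a) * (q x ^ 3 * (x k ^ 2 - 1)) + 16 * (q x ^ 2 * l x ^ 2 * x k ^ 2)) P :=
      k3.add (i4.const_mul _)
    have k5 : Integrable (fun x => q x ^ 4 + 4 * (q x ^ 3 * l x * x k)
      + (4 * a) * (q x ^ 3 * (x k ^ 2 - 1)) + 16 * (q x ^ 2 * l x ^ 2 * x k ^ 2)
      + (16 * a ^ 2) * (q x ^ 2 * (x k ^ 2 - 1) ^ 2)) P :=
      k4.add (i5.const_mul _)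
    have k6 : Integrable (fun x => q x ^ 4 + 4 * (q x ^ 3 * l x * x k)
      + (4 * a) * (q x ^ 3 * (x k ^ 2 - 1)) + 16 * (q x ^ 2 * l x ^ 2 * x k ^ 2)
      + (16 * a ^ 2) * (q x ^ 2 * (x k ^ 2 - 1) ^ 2) + 24 * (l x ^ 4 * x k ^ 4)) P :=
      k5.add (i6.const_mul _)
    have k7 : Integrable (fun x => q x ^ 4 + 4 * (q x ^ 3 * l x * x k)
      + (4 * a) * (q x ^ 3 * (x k ^ 2 - 1)) + 16 * (q x ^ 2 * l x ^ 2 * x k ^ 2)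
      + (16 * a ^ 2) * (q x ^ 2 * (x k ^ 2 - 1) ^ 2) + 24 * (l x ^ 4 * x k ^ 4)
      + (24 * a ^ 4) * (x k ^ 2 - 1) ^ 4) P :=
      k6.add (i7.const_mul _)
    have main : ∫ x, qf A (insert k s) x ^ 4 ∂P ≤ ∫ x, (q x ^ 4 + 4 * (q x ^ 3 * l x * x k)
      + (4 * a) * (q x ^ 3 * (x k ^ 2 - 1)) + 16 * (q x ^ 2 * l x ^ 2 * x k ^ 2)
      + (16 * a ^ 2) * (q x ^ 2 * (x k ^ 2 - 1) ^ 2) + 24 * (l x ^ 4 * x k ^ 4)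
      + (24 * a ^ 4) * (x k ^ 2 - 1) ^ 4) ∂P := by
      refine integral_mono_of_nonneg (Eventually.of_forall fun x => by positivity) k7
        (Eventually.of_forall fun x => ?_)
      simp only
      rw [qf_insert hA hk, ← hl, ← hq]
      change (q x + (l x * x k + a * (x k ^ 2 - 1))) ^ 4 ≤ _
      generalize q x = y
      have hu : l x ^ 4 * x k ^ 4 = (l x * x k) ^ 4 := by ring
      have hv : (24 * a ^ 4) * (x k ^ 2 - 1) ^ 4 = 24 * (a * (x k ^ 2 - 1)) ^ 4 := by ring
      have hw : (16 * a ^ 2) * (y ^ 2 * (x k ^ 2 - 1) ^ 2) = 16 * (y ^ 2 * (a * (x k ^ 2 - 1)) ^ 2) := by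
        ring
      have hw2 : y ^ 2 * l x ^ 2 * x k ^ 2 = y ^ 2 * (l x * x k) ^ 2 := by ring
      have hw3 : (4 * a) * (y ^ 3 * (x k ^ 2 - 1)) = 4 * y ^ 3 * (a * (x k ^ 2 - 1)) := by ring
      have hw4 : 4 * (y ^ 3 * l x * x k) = 4 * y ^ 3 * (l x * x k) := by ring
      rw [hu, hv, hw, hw2, hw3, hw4]
      generalize l x * x k = u
      generalize a * (x k ^ 2 - 1) = v
      exact quart_ineq y u v
    rw [integral_add k6 (i7.const_mul _), integral_add k5 (i6.const_mul _),
      integral_add k4 (i5.const_mul _), integral_add k3 (i4.const_mul _),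
      integral_add k2 (i3.const_mul _), integral_add i1 (i2.const_mul _),
      integral_const_mul, integral_const_mul, integral_const_mul, integral_const_mul,
      integral_const_mul, integral_const_mul, j2, j3, j4, j5, j6] at main
    have cs := cs_int (μ := P) (f := fun x => q x ^ 2) (g := fun x => l x ^ 2)
      (by simpa only [← pow_mul] using i1)
      (by simpa only [← pow_mul] using PolyIn.integrable hP (by norm_num) (PolyIn.pow ml 4))
      (PolyIn.integrable hP (by norm_num) (PolyIn.mul (PolyIn.pow mq 2) (PolyIn.pow ml 2)))
    simp only [← pow_mul] at cs
    norm_num at cs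
    set p := ∫ x, q x ^ 2 ∂P
    set r := ∫ x, l x ^ 2 ∂P
    set Z := ∫ x, q x ^ 2 * l x ^ 2 ∂P
    have hp : 0 ≤ p := integral_nonneg fun x => by positivity
    have hr : 0 ≤ r := integral_nonneg fun x => by positivity
    have hZ : 0 ≤ Z := integral_nonneg fun x => by positivity
    have hZ2 : 8 * Z ≤ K * (p * r) := by
      refine (pow_le_pow_iff_left₀ (by positivity) (by positivity) two_ne_zero).1 ?_
      have hl0 : 0 ≤ ∫ x, l x ^ 4 ∂P := integral_nonneg fun x => by positivity
      calc (8 * Z) ^ 2 = 64 * Z ^ 2 := by ring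
        _ ≤ 64 * ((K * p ^ 2) * ((4 + C₀) * r ^ 2)) := by
            gcongr
            exact cs.trans (mul_le_mul ih l4 hl0 (by positivity))
        _ = (64 * (4 + C₀)) * K * (p * r) ^ 2 := by ring
        _ ≤ K * K * (p * r) ^ 2 := by gcongr
        _ = _ := by ring
    have hκ : 0 < Δ + 2 := by linarith
    have t1 : 24 * ((∫ x, l x ^ 4 ∂P) * ∫ x, x k ^ 4 ∂P) ≤ K * r ^ 2 := by
      have h0 : 0 ≤ ∫ x : Fin d → ℝ, x k ^ 4 ∂P := integral_nonneg fun x => by positivity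
      calc _ ≤ 24 * (((4 + C₀) * r ^ 2) * (1 + C₀)) := by gcongr
        _ = (24 * (4 + C₀) * (1 + C₀)) * r ^ 2 := by ring
        _ ≤ _ := by gcongr
    have t2 : 24 * a ^ 4 * ∫ x, (x k ^ 2 - 1) ^ 4 ∂P ≤ K * (a ^ 2 * (Δ + 2)) ^ 2 := by
      calc _ ≤ 24 * a ^ 4 * (8 * (C₀ + 1)) := by gcongr
        _ = a ^ 4 * (192 * (C₀ + 1)) := by ring
        _ ≤ a ^ 4 * (K * (Δ + 2) ^ 2) := by gcongr
        _ = _ := by ring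
    set w := a ^ 2 * (Δ + 2) with hw
    have hw0 : 0 ≤ w := by positivity
    have t3 : 16 * a ^ 2 * (p * (Δ + 2)) ≤ 2 * K * (p * w) := by
      have : 16 * a ^ 2 * (p * (Δ + 2)) = 16 * (p * w) := by rw [hw]; ring
      rw [this]
      have : (8:ℝ) ≤ K := by linarith
      nlinarith [mul_nonneg hp hw0]
    have t4 : 0 ≤ K * (r * w) := by positivity
    have e4 : K * (p + r + w) ^ 2 = K * p ^ 2 + K * r ^ 2 + K * w ^ 2 + 2 * (K * (p * r))
      + 2 * K * (p * w) + 2 * (K * (r * w)) := by ring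
    rw [e4]
    linarith

end

section
variable {d : ℕ} {P : Measure (Fin d → ℝ)} {Δ C₀ : ℝ}

/-- the (scaled) centred second moment matrix of the second sample -/
def Amat {m : ℕ} (y : Fin m → Fin d → ℝ) (i k : Fin d) : ℝ :=
  (∑ j, (y j i * y j k - if i = k then 1 else 0)) / m

lemma Amat_symm {m : ℕ} (y : Fin m → Fin d → ℝ) (i k : Fin d) : Amat y i k = Amat y k i := by
  unfold Amat
  congr 1
  refine Finset.sum_congr rfl fun j _ => ?_
  rw [mul_comm]
  simp only [eq_comm]

lemma hCov_eq (x y : Fin d → ℝ) :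
    hCov d x y = qf (fun i k => y i * y k - if i = k then 1 else 0) Finset.univ x := by
  unfold hCov qf dot
  have e1 : (∑ i, x i * y i) ^ 2 = ∑ i, ∑ k, (y i * y k) * (x i * x k) := by
    rw [sq, Finset.sum_mul_sum]
    exact Finset.sum_congr rfl fun i _ => Finset.sum_congr rfl fun k _ => by ring
  rw [e1]
  simp only [sub_mul, Finset.sum_sub_distrib, ite_mul, one_mul, zero_mul, Finset.sum_ite_eq,
    Finset.mem_univ, if_true]
  simp
  ring

lemma f_eq {m : ℕ} (y : Fin m → Fin d → ℝ) (x : Fin d → ℝ) :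
    (∑ j, hCov d x (y j)) / m = qf (Amat y) Finset.univ x := by
  simp_rw [hCov_eq]
  unfold qf Amat
  rw [Finset.sum_sub_distrib, sub_div]
  congr 1
  · rw [Finset.sum_comm, Finset.sum_div]
    refine Finset.sum_congr rfl fun i _ => ?_
    rw [Finset.sum_comm, Finset.sum_div]
    refine Finset.sum_congr rfl fun k _ => ?_
    rw [← Finset.sum_mul, div_mul_eq_mul_div]
  · rw [Finset.sum_comm, Finset.sum_div]

lemma append_map {E : Type*} [MeasurableSpace E] (μ : Measure E) [IsProbabilityMeasure μ] (a b : ℕ) :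
    ((Measure.pi fun _ : Fin a => μ).prod (Measure.pi fun _ : Fin b => μ)).map
      (fun p => Fin.append p.1 p.2) = Measure.pi fun _ : Fin (a + b) => μ := by
  have hm : Measurable (fun p : (Fin a → E) × (Fin b → E) => Fin.append p.1 p.2) := by
    rw [measurable_pi_iff]
    intro i
    refine Fin.addCases (fun j => ?_) (fun j => ?_) i
    · simp only [Fin.append_left]; fun_prop
    · simp only [Fin.append_right]; fun_prop
  symm
  refine Measure.pi_eq fun s hs => ?_
  rw [Measure.map_apply hm (MeasurableSet.univ_pi hs)]
  have e : (fun p : (Fin a → E) × (Fin b → E) => Fin.append p.1 p.2) ⁻¹' (Set.univ.pi s) =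
      (Set.univ.pi fun i => s (Fin.castAdd b i)) ×ˢ (Set.univ.pi fun j => s (Fin.natAdd a j)) := by
    ext p
    simp only [Set.mem_preimage, Set.mem_pi, Set.mem_univ, true_implies, Set.mem_prod]
    constructor
    · intro h
      refine ⟨fun i => ?_, fun j => ?_⟩
      · have := h (Fin.castAdd b i); rwa [Fin.append_left] at this
      · have := h (Fin.natAdd a j); rwa [Fin.append_right] at this
    · rintro ⟨h1, h2⟩ i
      refine Fin.addCases (fun j => ?_) (fun j => ?_) i
      · rw [Fin.append_left]; exact h1 j
      · rw [Fin.append_right]; exact h2 j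
  rw [e, Measure.prod_prod, Measure.pi_pi, Measure.pi_pi, Fin.prod_univ_add]

lemma pm_of_outer {v w : Fin d → ℝ} (h : ∀ i k, v i * v k = w i * w k) : w = v ∨ w = -v := by
  by_cases hv : ∃ i, v i ≠ 0
  · obtain ⟨i, hi⟩ := hv
    have h1 := h i i
    rcases mul_self_eq_mul_self_iff.1 h1.symm with h2 | h2
    · left
      ext k
      have := h i k
      rw [h2] at this
      exact (mul_left_cancel₀ hi this).symm
    · right
      ext k
      have := h i k
      rw [h2] at this
      have h3 : v i * (v k) = v i * (- w k) := by rw [this]; ring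
      have := mul_left_cancel₀ hi h3
      rw [Pi.neg_apply, this, neg_neg]
  · push Not at hv
    left
    ext k
    have := h k k
    rw [hv k] at this ⊢
    simpa using this.symm

lemma null_A [IsProbabilityMeasure P] (hP : ∀ x, P {x} = 0) {m : ℕ} (hm : 0 < m) :
    (Measure.pi fun _ : Fin m => P) {y | ∀ i k, Amat y i k = 0} = 0 := by
  obtain ⟨n, rfl⟩ : ∃ n, m = n + 1 := ⟨m - 1, by omega⟩
  have mp := measurePreserving_piFinSuccAbove (fun _ : Fin (n + 1) => P) 0
  set S : Set ((Fin d → ℝ) × (Fin n → Fin d → ℝ)) := {p | ∀ i k, p.1 i * p.1 k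
    = (if i = k then 1 else 0) - ∑ j, (p.2 j i * p.2 j k - if i = k then 1 else 0)} with hS
  have hSm : MeasurableSet S := by
    rw [hS]
    simp only [Set.setOf_forall]
    refine MeasurableSet.iInter fun i => MeasurableSet.iInter fun k => ?_
    exact measurableSet_eq_fun (by fun_prop) (by fun_prop)
  have hsub : {y : Fin (n + 1) → Fin d → ℝ | ∀ i k, Amat y i k = 0} ⊆
      (MeasurableEquiv.piFinSuccAbove (fun _ : Fin (n + 1) => Fin d → ℝ) 0) ⁻¹' S := by
    intro y hy i k
    have h1 := hy i k
    unfold Amat at h1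
    rw [div_eq_zero_iff] at h1
    rcases h1 with h1 | h1
    · rw [Fin.sum_univ_succ] at h1
      change y 0 i * y 0 k = (if i = k then 1 else 0)
        - ∑ j : Fin n, (y (Fin.succAbove 0 j) i * y (Fin.succAbove 0 j) k - if i = k then 1 else 0)
      simp only [Fin.zero_succAbove]
      linarith
    · exfalso
      have : ((n + 1 : ℕ) : ℝ) ≠ 0 := by positivity
      exact this h1
  refine measure_mono_null hsub ?_
  rw [mp.measure_preimage hSm.nullMeasurableSet, Measure.prod_apply_symm hSm]
  rw [lintegral_eq_zero_iff' (measurable_measure_prodMk_right hSm).aemeasurable]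
  refine Eventually.of_forall fun r => ?_
  simp only [Pi.zero_apply]
  by_cases hne : ∃ v, (v, r) ∈ S
  · obtain ⟨v, hv⟩ := hne
    refine measure_mono_null (t := {v} ∪ {-v}) ?_ (measure_union_null (hP v) (hP (-v)))
    intro w hw
    have : ∀ i k, v i * v k = w i * w k := fun i k => (hv i k).trans (hw i k).symm
    rcases pm_of_outer this with h | h
    · exact Or.inl h
    · exact Or.inr h
  · have : (fun x => (x, r)) ⁻¹' S = ∅ := by
      ext v
      simp only [Set.mem_preimage, Set.mem_empty_iff_false, iff_false]
      exact fun h => hne ⟨v, h⟩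
    rw [this, measure_empty]

end

theorem cross_cov_uniform_berry_esseen
    (c C₀ : ℝ) (hc : 0 < c) (hC₀ : 0 < C₀) :
    ∃ C : ℝ, 0 < C ∧
      ∀ (d m₁ m₂ : ℕ), 0 < m₁ → 0 < m₂ →
        ∀ (Δ : ℝ), c < Δ + 2 →
          ∀ P : Measure (Fin d → ℝ), CovModel P Δ C₀ →
            ∀ z : ℝ,
              |((Measure.pi fun _ : Fin (m₁ + m₂) => P)
                  {ω | Tcov d m₁ m₂ ω ≤ z}).toReal - Φ z| ≤ C / Real.sqrt m₁ := by
  have hK8 : 0 < K8 c C₀ := by unfold K8; positivity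
  refine ⟨60010 * (K8 c C₀ + 1) ^ 2, by positivity, ?_⟩
  intro d m₁ m₂ hm₁ hm₂ Δ hΔ P hP z
  have hpr : IsProbabilityMeasure P := hP.1
  set S : Set ((Fin m₁ → Fin d → ℝ) × (Fin m₂ → Fin d → ℝ)) :=
    {p | studentized m₁ (fun i => qf (Amat p.2) Finset.univ (p.1 i)) ≤ z} with hS
  have hSm : MeasurableSet S := by
    refine measurableSet_le ((stud_meas m₁).comp ?_) measurable_const
    rw [measurable_pi_iff]
    intro i
    unfold qf Amat
    fun_prop
  have hTm : MeasurableSet {ω | Tcov d m₁ m₂ ω ≤ z} := by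
    refine measurableSet_le ((stud_meas m₁).comp ?_) measurable_const
    rw [measurable_pi_iff]
    intro i
    unfold hCov dot
    fun_prop
  have hm : Measurable (fun p : (Fin m₁ → Fin d → ℝ) × (Fin m₂ → Fin d → ℝ) =>
      Fin.append p.1 p.2) := by
    rw [measurable_pi_iff]
    intro i
    refine Fin.addCases (fun j => ?_) (fun j => ?_) i
    · simp only [Fin.append_left]; fun_prop
    · simp only [Fin.append_right]; fun_prop
  rw [← append_map P m₁ m₂, Measure.map_apply hm hTm]
  have e : (fun p : (Fin m₁ → Fin d → ℝ) × (Fin m₂ → Fin d → ℝ) => Fin.append p.1 p.2) ⁻¹'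
      {ω | Tcov d m₁ m₂ ω ≤ z} = S := by
    ext p
    simp only [Set.mem_preimage, Set.mem_setOf_eq, hS, Tcov, Fin.append_left, Fin.append_right,
      f_eq]
  rw [e, Measure.prod_apply_symm hSm]
  have hmeas := measurable_measure_prodMk_right (μ := Measure.pi fun _ : Fin m₁ => P) hSm
  rw [← integral_toReal hmeas.aemeasurable (Eventually.of_forall fun y => measure_lt_top _ _)]
  have hIntg : Integrable (fun y => ((Measure.pi fun _ : Fin m₁ => P)
      ((fun x => (x, y)) ⁻¹' S)).toReal) (Measure.pi fun _ : Fin m₂ => P) := by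
    refine Integrable.of_bound hmeas.ennreal_toReal.aestronglyMeasurable 1
      (Eventually.of_forall fun y => ?_)
    rw [Real.norm_eq_abs, abs_of_nonneg ENNReal.toReal_nonneg]
    exact measureReal_le_one
  have hΦ : Φ z = ∫ _y, Φ z ∂(Measure.pi fun _ : Fin m₂ => P) := by simp
  rw [hΦ, ← integral_sub hIntg (integrable_const _), ← Real.norm_eq_abs]
  refine (norm_integral_le_of_norm_le_const (C := 60010 * (K8 c C₀ + 1) ^ 2 / Real.sqrt m₁)
    ?_).trans (by simp)
  have hnull := null_A (P := P) hP.2.1 hm₂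
  have hae : ∀ᵐ y ∂(Measure.pi fun _ : Fin m₂ => P), ¬ ∀ i k, Amat y i k = 0 := by
    rw [ae_iff]; simpa using hnull
  filter_upwards [hae] with y hy
  rw [Real.norm_eq_abs]
  have hsym := Amat_symm y
  have hmq : qf (Amat y) Finset.univ ∈ PolyIn Finset.univ 2 := qf_mem _ _
  refine self_norm_gen (μ := P) (f := qf (Amat y) Finset.univ) (by unfold qf; fun_prop)
    (PolyIn.integrable hP (by norm_num) (PolyIn.pow hmq 4)) (qf_int hP hsym _) ?_
    (qf_four hP hC₀ hc hΔ hsym _) hm₁ z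
  have h0 : 0 ≤ ∫ x, qf (Amat y) Finset.univ x ^ 2 ∂P := integral_nonneg fun x => by positivity
  refine lt_of_le_of_ne h0 fun h => hy ?_
  have := qf_zero hP (by linarith) hsym Finset.univ h.symm
  exact fun i k => this i (Finset.mem_univ _) k (Finset.mem_univ _)

end
end
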